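/- Let R be a non-regular Gorenstein Noetherian local ring. Then there exists a finitely generated R-module that is G–Gorenstein but not Gorenstein; i.e., the class of G–Gorenstein modules strictly contains that of Gorenstein modules. -/

import Mathlib

universe u

namespace GG

open RingTheory.Sequence

variable (R : Type u) [CommRing R]

/-- A module `N` is Gorenstein injective if it is a kernel in a `Hom(Inj,−)`-exact exact
doubly infinite complex of injective modules. -/
def IsGorensteinInjective (N : Type u) [AddCommGroup N] [Module R N] : Prop :=
  ∃ (X : ℤ → ModuleCat.{u} R) (d : ∀ n : ℤ, X n →ₗ[R] X (n + 1)),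
    (∀ n, Module.Injective R (X n)) ∧
    (∀ n, LinearMap.range (d n) = LinearMap.ker (d (n + 1))) ∧
    (∀ (I : ModuleCat.{u} R), Module.Injective R I →
      ∀ (n : ℤ) (φ : I →ₗ[R] X (n + 1)), (d (n + 1)).comp φ = 0 →
        ∃ ψ : I →ₗ[R] X n, (d n).comp ψ = φ) ∧
    Nonempty (N ≃ₗ[R] LinearMap.ker (d 0))

/-- A module `N` is Gorenstein projective if it is a kernel in a `Hom(−,Proj)`-exact exact
doubly infinite complex of projective modules. -/
def IsGorensteinProjective (N : Type u) [AddCommGroup N] [Module R N] : Prop :=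
  ∃ (X : ℤ → ModuleCat.{u} R) (d : ∀ n : ℤ, X n →ₗ[R] X (n + 1)),
    (∀ n, Module.Projective R (X n)) ∧
    (∀ n, LinearMap.range (d n) = LinearMap.ker (d (n + 1))) ∧
    (∀ (P : ModuleCat.{u} R), Module.Projective R P →
      ∀ (n : ℤ) (φ : X (n + 1) →ₗ[R] P), φ.comp (d n) = 0 →
        ∃ ψ : X (n + 1 + 1) →ₗ[R] P, ψ.comp (d (n + 1)) = φ) ∧
    Nonempty (N ≃ₗ[R] LinearMap.ker (d 0))

/-- A module `N` is Gorenstein flat if it is a kernel in an `(Inj ⊗ −)`-exact exact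
doubly infinite complex of flat modules. -/
def IsGorensteinFlat (N : Type u) [AddCommGroup N] [Module R N] : Prop :=
  ∃ (X : ℤ → ModuleCat.{u} R) (d : ∀ n : ℤ, X n →ₗ[R] X (n + 1)),
    (∀ n, Module.Flat R (X n)) ∧
    (∀ n, LinearMap.range (d n) = LinearMap.ker (d (n + 1))) ∧
    (∀ (I : ModuleCat.{u} R), Module.Injective R I →
      ∀ n : ℤ, LinearMap.range (LinearMap.lTensor (R := R) I (d n)) =
        LinearMap.ker (LinearMap.lTensor (R := R) I (d (n + 1)))) ∧
    Nonempty (N ≃ₗ[R] LinearMap.ker (d 0))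

/-- Existence of a right resolution of length `≤ n` by modules satisfying `P`. -/
def CoresolutionLE (P : ModuleCat.{u} R → Prop) (M : Type u) [AddCommGroup M] [Module R M]
    (n : ℕ) : Prop :=
  ∃ (G : ℕ → ModuleCat.{u} R) (d : ∀ i : ℕ, G i →ₗ[R] G (i + 1)) (ε : M →ₗ[R] G 0),
    (∀ i, P (G i)) ∧ Function.Injective ε ∧
    LinearMap.range ε = LinearMap.ker (d 0) ∧
    (∀ i, LinearMap.range (d i) = LinearMap.ker (d (i + 1))) ∧
    (∀ i, n < i → ∀ x : G i, x = 0)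

/-- Existence of a left resolution of length `≤ n` by modules satisfying `P`. -/
def ResolutionLE (P : ModuleCat.{u} R → Prop) (M : Type u) [AddCommGroup M] [Module R M]
    (n : ℕ) : Prop :=
  ∃ (G : ℕ → ModuleCat.{u} R) (d : ∀ i : ℕ, G (i + 1) →ₗ[R] G i) (ε : G 0 →ₗ[R] M),
    (∀ i, P (G i)) ∧ Function.Surjective ε ∧
    LinearMap.ker ε = LinearMap.range (d 0) ∧
    (∀ i, LinearMap.ker (d i) = LinearMap.range (d (i + 1))) ∧
    (∀ i, n < i → ∀ x : G i, x = 0)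

/-- `Gid_R M ≤ n`. -/
def gidLE (M : Type u) [AddCommGroup M] [Module R M] (n : ℕ) : Prop :=
  CoresolutionLE R (fun N => IsGorensteinInjective R N) M n

/-- `id_R M ≤ n`. -/
def idLE (M : Type u) [AddCommGroup M] [Module R M] (n : ℕ) : Prop :=
  CoresolutionLE R (fun N => Module.Injective R N) M n

/-- `pd_R M ≤ n`. -/
def pdLE (M : Type u) [AddCommGroup M] [Module R M] (n : ℕ) : Prop :=
  ResolutionLE R (fun N => Module.Projective R N) M n

/-- `fd_R M ≤ n`. -/
def fdLE (M : Type u) [AddCommGroup M] [Module R M] (n : ℕ) : Prop :=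
  ResolutionLE R (fun N => Module.Flat R N) M n

/-- `Gfd_R M ≤ n`. -/
def gfdLE (M : Type u) [AddCommGroup M] [Module R M] (n : ℕ) : Prop :=
  ResolutionLE R (fun N => IsGorensteinFlat R N) M n

/-- Gorenstein injective dimension, as an extended natural number. -/
noncomputable def gid (M : Type u) [AddCommGroup M] [Module R M] : ℕ∞ :=
  sInf {c : ℕ∞ | ∃ n : ℕ, c = n ∧ gidLE R M n}

/-- The depth of a module over a local ring: the supremum of the lengths of regular
sequences contained in the maximal ideal. -/
noncomputable def mdepth [IsLocalRing R] (M : Type u) [AddCommGroup M] [Module R M] : ℕ∞ :=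
  sSup {c : ℕ∞ | ∃ rs : List R, c = rs.length ∧
    (∀ r ∈ rs, r ∈ IsLocalRing.maximalIdeal R) ∧ RingTheory.Sequence.IsRegular M rs}

/-- The Krull dimension of a module: the Krull dimension of its support. -/
noncomputable def mdim (M : Type u) [AddCommGroup M] [Module R M] : WithBot ℕ∞ :=
  Order.krullDim ↥(Module.support R M)

/-- The height of a prime in the support of `M`. -/
noncomputable def htM (M : Type u) [AddCommGroup M] [Module R M] (p : PrimeSpectrum R) : ℕ∞ :=
  ⨆ h : p ∈ Module.support R M, Order.height (⟨p, h⟩ : ↥(Module.support R M))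

/-- A Cohen–Macaulay module over a local ring: depth equals Krull dimension. -/
def IsCMModule [IsLocalRing R] (M : Type u) [AddCommGroup M] [Module R M] : Prop :=
  (mdepth R M : WithBot ℕ∞) = mdim R M

/-- A maximal Cohen–Macaulay module over a local ring. -/
def IsMaximalCM [IsLocalRing R] (M : Type u) [AddCommGroup M] [Module R M] : Prop :=
  IsCMModule R M ∧ mdim R M = ringKrullDim R

/-- A Cohen–Macaulay local ring. -/
def IsCMLocalRing [IsLocalRing R] : Prop :=
  (mdepth R R : WithBot ℕ∞) = ringKrullDim R

/-- A Gorenstein local ring: a Noetherian local ring of finite self-injective dimension. -/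
def IsGorensteinLocalRing [IsLocalRing R] : Prop :=
  IsNoetherianRing R ∧ ∃ n : ℕ, idLE R R n

/-- A regular local ring: Noetherian, and the maximal ideal is generated by `dim R` elements. -/
def IsRegularLocal [IsLocalRing R] : Prop :=
  IsNoetherianRing R ∧ ∃ s : Finset R, Ideal.span (s : Set R) = IsLocalRing.maximalIdeal R ∧
    (s.card : WithBot ℕ∞) = ringKrullDim R

/-- A (not necessarily local) Gorenstein ring: all localizations at primes are Gorenstein. -/
def IsGorensteinRing : Prop :=
  ∀ p : PrimeSpectrum R, ∃ n : ℕ,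
    idLE (Localization.AtPrime p.asIdeal) (Localization.AtPrime p.asIdeal) n

/-- `R` admits a dualizing complex; by Kawasaki's theorem this is equivalent to being a
homomorphic image of a finite-dimensional Gorenstein ring. -/
def HasDualizingComplex : Prop :=
  ∃ Q : CommRingCat.{u}, IsNoetherianRing Q ∧ ringKrullDim Q < ⊤ ∧ IsGorensteinRing Q ∧
    ∃ f : Q →+* R, Function.Surjective f

section Cousin

/-- The product of the localizations of `N` at the primes in `S`. -/
noncomputable abbrev locProd (S : Set (PrimeSpectrum R)) (N : Type u) [AddCommGroup N]
    [Module R N] : Type u :=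
  Π p : S, LocalizedModule p.1.asIdeal.primeCompl N

/-- The submodule of the product of localizations consisting of finitely supported families;
this is the direct sum `⊕_{p ∈ S} N_p`. -/
noncomputable def finSupp (S : Set (PrimeSpectrum R)) (N : Type u) [AddCommGroup N]
    [Module R N] : Submodule R (locProd R S N) where
  carrier := {f | {p : S | f p ≠ 0}.Finite}
  add_mem' := by
    intro f g hf hg
    refine (hf.union hg).subset ?_
    intro p hp
    by_contra h
    simp only [Set.mem_union, Set.mem_setOf_eq, not_or, not_not] at h
    exact hp (by simp [Pi.add_apply, h.1, h.2])
  zero_mem' := by simp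
  smul_mem' := by
    intro c f hf
    refine hf.subset ?_
    intro p hp
    by_contra h
    simp only [Set.mem_setOf_eq, not_not] at h
    exact hp (by simp [Pi.smul_apply, h])

/-- The canonical map `N → ∏_{p ∈ S} N_p`. -/
noncomputable def thetaFull (S : Set (PrimeSpectrum R)) (N : Type u) [AddCommGroup N]
    [Module R N] : N →ₗ[R] locProd R S N :=
  LinearMap.pi fun p => LocalizedModule.mkLinearMap p.1.asIdeal.primeCompl N

/-- The cokernel of `N → ⊕_{p ∈ S} N_p` (computed inside the direct sum). -/
noncomputable abbrev nextKType (S : Set (PrimeSpectrum R)) (N : Type u) [AddCommGroup N]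
    [Module R N] : Type u :=
  ↥(finSupp R S N) ⧸
    (Submodule.comap (finSupp R S N).subtype (LinearMap.range (thetaFull R S N)))

/-- The sequence of "kernel/cokernel" modules in the inductive construction
of the Cousin complex of `M` with respect to the filtration `F`. -/
noncomputable def cousinK (F : ℕ → Set (PrimeSpectrum R)) (M : ModuleCat.{u} R) :
    ℕ → ModuleCat.{u} R
  | 0 => M
  | n + 1 => ModuleCat.of R (nextKType R (F n \ F (n + 1)) (cousinK F M n))

/-- The `n`-th term `M^n = ⊕_{p ∈ ∂F_n} (coker d^{n-2})_p` of the Cousin complex. -/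
noncomputable abbrev cousinC (F : ℕ → Set (PrimeSpectrum R)) (M : ModuleCat.{u} R) (n : ℕ) :
    Type u :=
  ↥(finSupp R (F n \ F (n + 1)) (cousinK R F M n))

/-- The canonical map from the `n`-th cokernel into the product of its localizations. -/
noncomputable def cousinTheta (F : ℕ → Set (PrimeSpectrum R)) (M : ModuleCat.{u} R) (n : ℕ) :
    (cousinK R F M n) →ₗ[R] locProd R (F n \ F (n + 1)) (cousinK R F M n) :=
  thetaFull R _ _

/-- The (full) `n`-th differential of the Cousin complex, from `M^n` to the product at
level `n+1` (it lands inside the direct sum `M^{n+1}`). -/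
noncomputable def cousinD (F : ℕ → Set (PrimeSpectrum R)) (M : ModuleCat.{u} R) (n : ℕ) :
    (cousinC R F M n) →ₗ[R] locProd R (F (n + 1) \ F (n + 2)) (cousinK R F M (n + 1)) :=
  (cousinTheta R F M (n + 1)).comp
    (Submodule.mkQ (Submodule.comap (finSupp R (F n \ F (n + 1)) (cousinK R F M n)).subtype
      (LinearMap.range (thetaFull R (F n \ F (n + 1)) (cousinK R F M n)))))

/-- `F` is a filtration of `Spec R`: descending, and every element of `∂F_n = F_n \ F_{n+1}`
is a minimal member of `F_n`. -/
def IsFiltration (F : ℕ → Set (PrimeSpectrum R)) : Prop :=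
  (∀ n, F (n + 1) ⊆ F n) ∧
    ∀ n, ∀ p ∈ F n \ F (n + 1), ∀ q ∈ F n, q ≤ p → q = p

/-- The filtration `F` admits `M`. -/
def Admits (F : ℕ → Set (PrimeSpectrum R)) (M : Type u) [AddCommGroup M] [Module R M] : Prop :=
  Module.support R M ⊆ F 0

/-- The `M`-height filtration `K_i = {p ∈ Supp M | ht_M p ≥ i}`. -/
noncomputable def heightFiltration (M : Type u) [AddCommGroup M] [Module R M] :
    ℕ → Set (PrimeSpectrum R) :=
  fun i => {p | p ∈ Module.support R M ∧ (i : ℕ∞) ≤ htM R M p}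

/-- The Cousin complex `C(F, M)` is exact at `M, M⁰, …, M^t`
(together with the well-definedness of the differentials into the direct sums). -/
def CousinPartiallyExact (F : ℕ → Set (PrimeSpectrum R)) (M : ModuleCat.{u} R) (t : ℕ) : Prop :=
  (∀ n, LinearMap.range (cousinTheta R F M n) ≤ finSupp R (F n \ F (n + 1)) (cousinK R F M n)) ∧
  Function.Injective (cousinTheta R F M 0) ∧
  (∀ n ≤ t, LinearMap.ker (cousinD R F M n) =
    Submodule.comap (finSupp R (F n \ F (n + 1)) (cousinK R F M n)).subtype
      (LinearMap.range (cousinTheta R F M n)))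

/-- The Cousin complex `C(F, M)` is exact and all of its terms satisfy `P`, i.e. it provides
a `P`-resolution of `M`. -/
def CousinResolves (F : ℕ → Set (PrimeSpectrum R)) (M : ModuleCat.{u} R)
    (P : ModuleCat.{u} R → Prop) : Prop :=
  (∀ n, LinearMap.range (cousinTheta R F M n) ≤ finSupp R (F n \ F (n + 1)) (cousinK R F M n)) ∧
  Function.Injective (cousinTheta R F M 0) ∧
  (∀ n, LinearMap.ker (cousinD R F M n) =
    Submodule.comap (finSupp R (F n \ F (n + 1)) (cousinK R F M n)).subtype
      (LinearMap.range (cousinTheta R F M n))) ∧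
  (∀ n, P (ModuleCat.of R (cousinC R F M n)))

/-- A G–Gorenstein module: a nonzero finitely generated module whose Cousin complex with
respect to the `M`-height filtration is a Gorenstein injective resolution. -/
def IsGGorenstein (M : ModuleCat.{u} R) : Prop :=
  (∃ x : M, x ≠ 0) ∧ Module.Finite R M ∧
    CousinResolves R (heightFiltration R M) M (fun N => IsGorensteinInjective R N)

/-- A Gorenstein module: a nonzero finitely generated module whose Cousin complex with
respect to the `M`-height filtration is an injective resolution. -/
def IsGorensteinModule (M : ModuleCat.{u} R) : Prop :=
  (∃ x : M, x ≠ 0) ∧ Module.Finite R M ∧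
    CousinResolves R (heightFiltration R M) M (fun N => Module.Injective R N)

end Cousin

/-- A system of parameters of a local ring. -/
def IsSOP [IsLocalRing R] (rs : List R) : Prop :=
  (rs.length : WithBot ℕ∞) = ringKrullDim R ∧
    (∀ r ∈ rs, r ∈ IsLocalRing.maximalIdeal R) ∧
    IsLocalRing.maximalIdeal R ≤ (Ideal.span {r | r ∈ rs}).radical

/-- A balanced big Cohen–Macaulay module: every system of parameters of `R` is a regular
sequence on `M`. -/
def IsBalancedBigCM [IsLocalRing R] (M : Type u) [AddCommGroup M] [Module R M] : Prop :=
  ∀ rs : List R, IsSOP R rs → RingTheory.Sequence.IsRegular M rs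

end GG

namespace GGP

open Matrix

section Act

variable {R : Type u} [CommRing R]

/-- The action of a matrix on tuples of elements of a module. -/
noncomputable def act {a b : ℕ} (A : Matrix (Fin b) (Fin a) R) (L : Type u) [AddCommGroup L]
    [Module R L] : (Fin a → L) →ₗ[R] (Fin b → L) :=
  LinearMap.pi fun i => ∑ j, A i j • LinearMap.proj j

variable {L : Type u} [AddCommGroup L] [Module R L]
variable {L' : Type u} [AddCommGroup L'] [Module R L']
variable {a b c d : ℕ}

theorem act_apply (A : Matrix (Fin b) (Fin a) R) (x : Fin a → L) (i : Fin b) :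
    act A L x i = ∑ j, A i j • x j := by
  simp [act]

theorem act_act (B : Matrix (Fin c) (Fin b) R) (A : Matrix (Fin b) (Fin a) R) (x : Fin a → L) :
    act B L (act A L x) = act (B * A) L x := by
  ext i
  simp only [act_apply, Matrix.mul_apply, Finset.smul_sum, Finset.sum_smul, smul_smul]
  rw [Finset.sum_comm]

theorem act_zero (x : Fin a → L) : act (0 : Matrix (Fin b) (Fin a) R) L x = 0 := by
  ext i; simp [act_apply]

theorem act_one (x : Fin a → L) : act (1 : Matrix (Fin a) (Fin a) R) L x = x := by
  ext i; simp [act_apply, Matrix.one_apply]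

theorem act_map (A : Matrix (Fin b) (Fin a) R) (f : L →ₗ[R] L') (x : Fin a → L) :
    act A L' (fun j => f (x j)) = fun i => f (act A L x i) := by
  ext i; simp [act_apply, map_sum]

/-- Exactness at the middle term of `L^a → L^b → L^c`. -/
def EX (A : Matrix (Fin b) (Fin a) R) (B : Matrix (Fin c) (Fin b) R) (L : Type u)
    [AddCommGroup L] [Module R L] : Prop :=
  ∀ x : Fin b → L, act B L x = 0 → ∃ y, act A L y = x

theorem EX_of_subsingleton (A : Matrix (Fin b) (Fin a) R) (B : Matrix (Fin c) (Fin b) R)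
    [Subsingleton L] : EX A B L := fun _ _ => ⟨0, Subsingleton.elim _ _⟩

theorem EX_equiv (e : L ≃ₗ[R] L') {A : Matrix (Fin b) (Fin a) R} {B : Matrix (Fin c) (Fin b) R}
    (h : EX A B L) : EX A B L' := by
  intro x hx
  obtain ⟨y, hy⟩ := h (fun j => e.symm (x j)) (by
    have := act_map B e.symm.toLinearMap x
    simp only [LinearEquiv.coe_coe] at this
    rw [this, hx]; ext; simp)
  refine ⟨fun j => e (y j), ?_⟩
  have := act_map A e.toLinearMap y
  simp only [LinearEquiv.coe_coe] at this
  rw [this, hy]; ext; simp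

theorem factor_of_injective {C X Y : Type u} [AddCommGroup C] [Module R C] [AddCommGroup X]
    [Module R X] [AddCommGroup Y] [Module R Y] (hC : Module.Injective R C) (v : X →ₗ[R] Y)
    (F : X →ₗ[R] C) (h : LinearMap.ker v ≤ LinearMap.ker F) : ∃ G : Y →ₗ[R] C, G ∘ₗ v = F := by
  obtain ⟨G, hG⟩ := hC.out ((LinearMap.ker v).liftQ v le_rfl)
    (by rw [← LinearMap.ker_eq_bot, Submodule.ker_liftQ_eq_bot _ _ _ le_rfl])
    ((LinearMap.ker v).liftQ F h)
  refine ⟨G, ?_⟩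
  ext x
  simpa using hG (Submodule.Quotient.mk x)

theorem EX_hom_of_injective {N C : Type u} [AddCommGroup N] [Module R N] [AddCommGroup C]
    [Module R C] (hC : Module.Injective R C)
    {A : Matrix (Fin b) (Fin a) R} {B : Matrix (Fin c) (Fin b) R}
    (h : EX Bᵀ Aᵀ N) : EX A B (N →ₗ[R] C) := by
  intro f hf
  let F : (Fin b → N) →ₗ[R] C := ∑ j, (f j) ∘ₗ LinearMap.proj j
  have hF : ∀ z, F (act Bᵀ N z) = 0 := by
    intro z
    have h2 : ∀ i, ∑ j, B i j • f j (z i) = 0 := by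
      intro i
      have := congrArg (fun g => g (z i)) (congrFun hf i)
      simpa [act_apply, LinearMap.sum_apply] using this
    simp only [F, LinearMap.sum_apply, LinearMap.comp_apply, LinearMap.proj_apply, act_apply,
      map_sum, map_smul, Matrix.transpose_apply]
    rw [Finset.sum_comm]
    exact Finset.sum_eq_zero fun i _ => h2 i
  obtain ⟨G, hG⟩ := factor_of_injective hC (act Aᵀ N) F (by
    intro x hx
    obtain ⟨z, rfl⟩ := h x (by simpa using hx)
    simpa using hF z)
  refine ⟨fun j => G ∘ₗ LinearMap.single R (fun _ => N) j, ?_⟩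
  ext i n
  have h3 := LinearMap.congr_fun hG (Pi.single i n)
  have h4 : F (Pi.single i n) = f i n := by
    simp only [F, LinearMap.sum_apply, LinearMap.comp_apply, LinearMap.proj_apply]
    rw [Finset.sum_eq_single i]
    · simp
    · intro j _ hj; simp [hj]
    · simp
  rw [h4] at h3
  rw [← h3, act_apply]
  simp only [LinearMap.sum_apply, LinearMap.smul_apply, LinearMap.comp_apply]
  simp only [← map_smul, ← map_sum]
  congr 1
  ext j
  simp only [act_apply, Finset.sum_apply, Matrix.transpose_apply]
  rw [Finset.sum_eq_single j, Finset.sum_eq_single i]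
  · simp
  · intro k _ hk; simp [hk]
  · simp
  · intro k _ hk; simp [hk.symm]
  · simp

theorem EX_of_injective {C : Type u} [AddCommGroup C]
    [Module R C] (hC : Module.Injective R C)
    {A : Matrix (Fin b) (Fin a) R} {B : Matrix (Fin c) (Fin b) R}
    (h : EX Bᵀ Aᵀ R) : EX A B C :=
  EX_equiv (LinearMap.ringLmapEquivSelf R R C) (EX_hom_of_injective hC h)

/-- A short exact sequence. -/
structure SES {K C K' : Type u} [AddCommGroup K] [Module R K] [AddCommGroup C] [Module R C]
    [AddCommGroup K'] [Module R K'] (i : K →ₗ[R] C) (p : C →ₗ[R] K') : Prop where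
  inj : Function.Injective i
  surj : Function.Surjective p
  zero : ∀ x, p (i x) = 0
  exact : ∀ y, p y = 0 → ∃ x, i x = y

variable {K C K' : Type u} [AddCommGroup K] [Module R K] [AddCommGroup C] [Module R C]
    [AddCommGroup K'] [Module R K'] {i : K →ₗ[R] C} {p : C →ₗ[R] K'}

theorem SES.lift (h : SES i p) (x : Fin a → K') : ∃ y : Fin a → C, (fun j => p (y j)) = x := by
  choose f hf using fun j => h.surj (x j)
  exact ⟨f, funext hf⟩

theorem SES.ex (h : SES i p) (x : Fin a → C) (hx : (fun j => p (x j)) = 0) :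
    ∃ y : Fin a → K, (fun j => i (y j)) = x := by
  choose f hf using fun j => h.exact (x j) (congrFun hx j)
  exact ⟨f, funext hf⟩

theorem SES.ascend (h : SES i p) {A : Matrix (Fin b) (Fin a) R} {B : Matrix (Fin c) (Fin b) R}
    {E : Matrix (Fin d) (Fin c) R} (hEB : E * B = 0) (h1 : EX A B C) (h2 : EX B E K) :
    EX A B K' := by
  intro x' hx'
  obtain ⟨x, rfl⟩ := h.lift x'
  rw [act_map] at hx'
  obtain ⟨z, hz⟩ := h.ex _ hx'
  obtain ⟨w, rfl⟩ := h2 z (by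
    have : (fun j => i (act E K z j)) = 0 := by
      rw [← act_map, hz]
      change act E C (act B C x) = 0
      rw [act_act, hEB, act_zero]
    ext j
    exact h.inj (by simpa using congrFun this j))
  obtain ⟨y, hy⟩ := h1 (x - fun j => i (w j)) (by
    rw [map_sub, act_map, hz]; simp)
  refine ⟨fun j => p (y j), ?_⟩
  rw [act_map, hy]
  ext j
  simp [h.zero]

theorem SES.descend (h : SES i p) {A : Matrix (Fin b) (Fin a) R} {B : Matrix (Fin c) (Fin b) R}
    {E : Matrix (Fin d) (Fin c) R} (hBA : B * A = 0) (h1 : EX B E C) (h2 : EX A B K') :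
    EX B E K := by
  intro z hz
  obtain ⟨x, hx⟩ := h1 (fun j => i (z j)) (by rw [act_map, hz]; ext; simp)
  obtain ⟨y', hy'⟩ := h2 (fun j => p (x j)) (by rw [act_map, hx]; ext; simp [h.zero])
  obtain ⟨y, rfl⟩ := h.lift y'
  rw [act_map] at hy'
  obtain ⟨w, hw⟩ := h.ex (x - act A C y) (by
    ext j; simpa [sub_eq_zero] using (congrFun hy' j).symm)
  refine ⟨w, ?_⟩
  have : (fun j => i (act B K w j)) = fun j => i (z j) := by
    rw [← act_map, hw, map_sub, hx, act_act, hBA, act_zero, sub_zero]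
  ext j
  exact h.inj (congrFun this j)

open GG in
theorem dim_shift (P : ℕ → ∀ (L : Type u) [AddCommGroup L] [Module R L], Prop)
    (hz : ∀ (i : ℕ) (L : Type u) [AddCommGroup L] [Module R L], Subsingleton L → P i L)
    (he : ∀ (i : ℕ) (L L' : Type u) [AddCommGroup L] [Module R L] [AddCommGroup L'] [Module R L'],
      (L ≃ₗ[R] L') → P i L → P i L')
    (hs : ∀ (n : ℕ) (K C K' : Type u) [AddCommGroup K] [Module R K] [AddCommGroup C] [Module R C]
      [AddCommGroup K'] [Module R K'] (i : K →ₗ[R] C) (p : C →ₗ[R] K'), SES i p →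
      Module.Injective R C → P n K' → P (n + 1) K)
    (L : Type u) [AddCommGroup L] [Module R L] (n : ℕ) (h : idLE R L n) (m : ℕ) (hm : n < m) :
    P m L := by
  obtain ⟨G, d, ε, hG, hε, h0, hd, hzero⟩ := h
  have key : ∀ k l : ℕ, n < k + l → P k (LinearMap.ker (d l)) := by
    intro k
    induction k with
    | zero =>
      intro l hl
      refine hz _ _ ⟨fun x y => Subtype.ext ?_⟩
      rw [hzero l (by omega) x, hzero l (by omega) y]
    | succ k ih =>
      intro l hl
      have hin : ∀ x, d l x ∈ LinearMap.ker (d (l + 1)) := by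
        intro x; rw [← hd]; exact ⟨x, rfl⟩
      refine hs k _ (G l) _ (LinearMap.ker (d l)).subtype ((d l).codRestrict _ hin) ?_ (hG l)
        (ih (l + 1) (by omega))
      constructor
      · exact Subtype.val_injective
      · rintro ⟨y, hy⟩
        rw [← hd] at hy
        obtain ⟨x, rfl⟩ := hy
        exact ⟨x, rfl⟩
      · rintro ⟨x, hx⟩
        exact Subtype.ext (by simpa using hx)
      · intro y hy
        exact ⟨⟨y, by simpa using congrArg Subtype.val hy⟩, rfl⟩
  refine he m _ _ ?_ (key m 0 (by omega))
  exact ((LinearEquiv.ofInjective ε hε).trans (LinearEquiv.ofEq _ _ h0)).symm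

end Act

end GGP

namespace GGP

open Matrix CategoryTheory

section Res

variable {R : Type u} [CommRing R]

/-- The short complex of a short exact sequence of modules. -/
noncomputable abbrev SES.cx {K C K' : Type u} [AddCommGroup K] [Module R K] [AddCommGroup C]
    [Module R C] [AddCommGroup K'] [Module R K'] {i : K →ₗ[R] C} {p : C →ₗ[R] K'}
    (h : SES i p) : ShortComplex (ModuleCat.{u} R) :=
  ShortComplex.mk (ModuleCat.ofHom i) (ModuleCat.ofHom p) (by
    ext x; exact h.zero x)

theorem SES.shortExact {K C K' : Type u} [AddCommGroup K] [Module R K] [AddCommGroup C]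
    [Module R C] [AddCommGroup K'] [Module R K'] {i : K →ₗ[R] C} {p : C →ₗ[R] K'}
    (h : SES i p) : h.cx.ShortExact := by
  refine ModuleCat.shortComplex_shortExact _ ?_ h.inj h.surj
  intro y
  constructor
  · intro hy
    obtain ⟨x, hx⟩ := h.exact y hy
    exact ⟨x, hx⟩
  · rintro ⟨x, rfl⟩
    exact h.zero x

/-- `SES` for a submodule. -/
theorem SES.ofSub {C : Type u} [AddCommGroup C] [Module R C] (S : Submodule R C) :
    SES S.subtype S.mkQ where
  inj := Subtype.val_injective
  surj := Submodule.mkQ_surjective _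
  zero := fun x => by simp
  exact := fun y hy => ⟨⟨y, by simpa using hy⟩, rfl⟩

theorem mul_eq_zero_of_act {a b c : ℕ} {B : Matrix (Fin c) (Fin b) R}
    {A : Matrix (Fin b) (Fin a) R} (h : ∀ x, act B R (act A R x) = 0) : B * A = 0 := by
  ext i j
  have := congrFun (h (Pi.single j 1)) i
  rw [act_act, act_apply] at this
  simpa [Pi.single_apply] using this

theorem cover [IsNoetherianRing R] {r : ℕ} (S : Submodule R (Fin r → R)) :
    ∃ (r' : ℕ) (A : Matrix (Fin r) (Fin r') R), LinearMap.range (act A R) = S ∧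
      ∃ (e : Fin r' → R) (j : Fin r'), act A R e = 0 ∧ e j = 1 := by
  obtain ⟨n, v, hv⟩ := Submodule.fg_iff_exists_fin_generating_family.mp (IsNoetherian.noetherian S)
  refine ⟨n + 1, Matrix.of fun i j => (Fin.cons 0 v : Fin (n + 1) → (Fin r → R)) j i, ?_,
    Pi.single 0 1, 0, ?_, by simp⟩
  · rw [← hv]
    have hact : ∀ x : Fin (n + 1) → R,
        act (Matrix.of fun i j => (Fin.cons 0 v : Fin (n + 1) → (Fin r → R)) j i) R x
          = ∑ k, x (Fin.succ k) • v k := by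
      intro x
      ext i
      rw [act_apply, Fin.sum_univ_succ]
      simp [mul_comm]
    apply le_antisymm
    · rintro _ ⟨x, rfl⟩
      rw [hact]
      exact Submodule.sum_mem _ fun k _ =>
        Submodule.smul_mem _ _ (Submodule.subset_span ⟨k, rfl⟩)
    · rw [Submodule.span_le]
      rintro _ ⟨k, rfl⟩
      refine ⟨Pi.single k.succ 1, ?_⟩
      rw [hact]
      simp [Pi.single_apply]
  · ext i
    rw [act_apply]
    simp [Fin.sum_univ_succ]

/-- A free resolution in matrix form, starting from a submodule of `R^r`. -/
theorem exists_res [IsNoetherianRing R] {r₀ : ℕ} (S₀ : Submodule R (Fin r₀ → R)) :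
    ∃ (r : ℕ → ℕ) (A : ∀ i, Matrix (Fin (r i)) (Fin (r (i + 1))) R) (h : r 0 = r₀),
      LinearMap.range (act (A 0) R) = S₀.comap (LinearMap.funLeft R R (Fin.cast h.symm)) ∧
      (∀ i, LinearMap.range (act (A (i + 1)) R) = LinearMap.ker (act (A i) R)) ∧
      (∀ i, ∃ (e : Fin (r (i + 1)) → R) (j : Fin (r (i + 1))), act (A i) R e = 0 ∧ e j = 1) := by
  choose r' A hA he using fun s : (Σ r : ℕ, Submodule R (Fin r → R)) => cover s.2
  let st : ℕ → (Σ r : ℕ, Submodule R (Fin r → R)) := fun n => Nat.rec ⟨r₀, S₀⟩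
    (fun _ s => ⟨r' s, LinearMap.ker (act (A s) R)⟩) n
  refine ⟨fun i => (st i).1, fun i => A (st i), rfl, ?_, ?_, ?_⟩
  · exact hA (st 0)
  · intro i
    exact hA (st (i + 1))
  · intro i
    exact he (st i)

theorem hasPD_step {K C K' : Type u} [AddCommGroup K] [Module R K] [AddCommGroup C]
    [Module R C] [AddCommGroup K'] [Module R K'] {i : K →ₗ[R] C} {p : C →ₗ[R] K'}
    (h : SES i p) [Module.Projective R C] (n : ℕ)
    (hK : HasProjectiveDimensionLT (ModuleCat.of R K) (n + 1)) :
    HasProjectiveDimensionLT (ModuleCat.of R K') (n + 2) :=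
  (h.shortExact.hasProjectiveDimensionLT_X₃_iff n
    (IsProjective.iff_projective C |>.mp inferInstance)).mpr hK

theorem hasPD_equiv {K K' : Type u} [AddCommGroup K] [Module R K]
    [AddCommGroup K'] [Module R K'] (e : K ≃ₗ[R] K') (n : ℕ)
    (hK : HasProjectiveDimensionLT (ModuleCat.of R K) n) :
    HasProjectiveDimensionLT (ModuleCat.of R K') n :=
  hasProjectiveDimensionLT_of_iso e.toModuleIso n

/-- The rank function of the spliced complex. -/
def spR (r q : ℕ → ℕ) : ℤ → ℕ
  | .ofNat j => r j
  | .negSucc j => q (j + 1)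

/-- The spliced complex. -/
def spD (r q : ℕ → ℕ) (h : q 0 = r 0) (U : ∀ j, Matrix (Fin (r (j + 1))) (Fin (r j)) R)
    (B : ∀ i, Matrix (Fin (q i)) (Fin (q (i + 1))) R) :
    ∀ n : ℤ, Matrix (Fin (spR r q (n + 1))) (Fin (spR r q n)) R
  | .ofNat j => U j
  | .negSucc 0 => (B 0).submatrix (Fin.cast h.symm) id
  | .negSucc (j + 1) => B (j + 1)

theorem EX_of_range {a b c : ℕ} {A : Matrix (Fin b) (Fin a) R} {B : Matrix (Fin c) (Fin b) R}
    (h : LinearMap.range (act A R) = LinearMap.ker (act B R)) : B * A = 0 ∧ EX A B R := by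
  constructor
  · apply mul_eq_zero_of_act
    intro x
    have : act A R x ∈ LinearMap.ker (act B R) := h ▸ ⟨x, rfl⟩
    simpa using this
  · intro x hx
    have : x ∈ LinearMap.range (act A R) := h ▸ (by simpa using hx)
    exact this

theorem EX_cast1 {a b b' c : ℕ} (h : b' = b) (U : Matrix (Fin c) (Fin b) R)
    (B : Matrix (Fin b') (Fin a) R) (h0 : LinearMap.range (act B R) =
      (LinearMap.ker (act U R)).comap (LinearMap.funLeft R R (Fin.cast h.symm))) :
    U * (B.submatrix (Fin.cast h.symm) id) = 0 ∧ EX (B.submatrix (Fin.cast h.symm) id) U R := by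
  subst h
  exact EX_of_range h0

theorem EX_cast2 {a b b' c : ℕ} (h : b' = b) (E : Matrix (Fin a) (Fin c) R)
    (B : Matrix (Fin b') (Fin a) R) (h0 : LinearMap.range (act E R) = LinearMap.ker (act B R)) :
    (B.submatrix (Fin.cast h.symm) id) * E = 0 ∧ EX E (B.submatrix (Fin.cast h.symm) id) R := by
  subst h
  exact EX_of_range h0

theorem spD_exact (r q : ℕ → ℕ) (h : q 0 = r 0) (U : ∀ j, Matrix (Fin (r (j + 1))) (Fin (r j)) R)
    (B : ∀ i, Matrix (Fin (q i)) (Fin (q (i + 1))) R)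
    (hU : ∀ j, U (j + 1) * U j = 0 ∧ EX (U j) (U (j + 1)) R)
    (hB : ∀ i, LinearMap.range (act (B (i + 1)) R) = LinearMap.ker (act (B i) R))
    (h0 : LinearMap.range (act (B 0) R) =
      (LinearMap.ker (act (U 0) R)).comap (LinearMap.funLeft R R (Fin.cast h.symm)))
    (n : ℤ) : spD r q h U B (n + 1) * spD r q h U B n = 0 ∧
      EX (spD r q h U B n) (spD r q h U B (n + 1)) R := by
  match n with
  | .ofNat j => exact hU j
  | .negSucc 0 => exact EX_cast1 h (U 0) (B 0) h0
  | .negSucc 1 => exact EX_cast2 h (B 1) (B 0) (hB 0)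
  | .negSucc (j + 2) => exact EX_of_range (hB (j + 1))

open GG in
theorem exists_tac [IsLocalRing R] [IsNoetherianRing R] (n : ℕ) (hid : idLE R R n) :
    ∃ (r : ℤ → ℕ) (D : ∀ n : ℤ, Matrix (Fin (r (n + 1))) (Fin (r n)) R),
      (∀ n, D (n + 1) * D n = 0) ∧ (∀ n, EX (D n) (D (n + 1)) R) ∧
      (∀ n, EX (D (n + 1))ᵀ (D n)ᵀ R) ∧
      (∃ x, act (D 0) R x = 0 ∧ ∀ a : R, a • x = 0 → a = 0) ∧
      (Module.Projective R ((Fin (r 0) → R) ⧸ LinearMap.range (act (D 0)ᵀ R)) →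
        ∃ m, HasProjectiveDimensionLT (ModuleCat.of R (IsLocalRing.ResidueField R)) m) := by
  obtain ⟨r, A, hr0, hA0, hA, he⟩ := exists_res (R := R) (r₀ := 1)
    (LinearMap.ker ((IsLocalRing.maximalIdeal R).mkQ ∘ₗ LinearMap.proj 0))
  -- dual exactness far out
  have hdual : ∀ m, n < m → EX (A m)ᵀ (A (m + 1))ᵀ R := by
    intro m hm
    refine dim_shift (R := R) (fun i L _ _ => EX (A i)ᵀ (A (i + 1))ᵀ L) ?_ ?_ ?_ R n hid m hm
    · intro i L _ _ hL
      exact EX_of_subsingleton _ _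
    · intro i L L' _ _ _ _ e h
      exact EX_equiv e h
    · intro n K C K' _ _ _ _ _ _ i p h hC hK'
      refine h.descend ?_ (EX_of_injective hC ?_) hK'
      · rw [← Matrix.transpose_mul, (EX_of_range (hA n)).1, Matrix.transpose_zero]
      · rw [Matrix.transpose_transpose, Matrix.transpose_transpose]
        exact (EX_of_range (hA (n + 1))).2
  obtain ⟨q, B, hq0, hB0, hB, -⟩ := exists_res (R := R) (r₀ := r (n + 2))
    (LinearMap.ker (act (A (n + 2))ᵀ R))
  have hsp := spD_exact (fun j => r (n + 2 + j)) q hq0 (fun j => (A (n + 2 + j))ᵀ) B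
    (by
      intro j
      refine ⟨?_, hdual _ (by omega)⟩
      have := (EX_of_range (hA (n + 2 + j))).1
      calc (A (n + 2 + j + 1))ᵀ * (A (n + 2 + j))ᵀ
          = (A (n + 2 + j) * A (n + 2 + j + 1))ᵀ := by rw [Matrix.transpose_mul]
        _ = 0 := by rw [this, Matrix.transpose_zero])
    hB hB0
  set D := spD (fun j => r (n + 2 + j)) q hq0 (fun j => (A (n + 2 + j))ᵀ) B with hD
  refine ⟨spR (fun j => r (n + 2 + j)) q, D, fun k => (hsp k).1, fun k => (hsp k).2, ?_, ?_, ?_⟩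
  · refine dim_shift (R := R) (fun _ L _ _ => ∀ k, EX (D (k + 1))ᵀ (D k)ᵀ L) ?_ ?_ ?_ R n hid
      (n + 1) (by omega)
    · intro i L _ _ hL k
      exact EX_of_subsingleton _ _
    · intro i L L' _ _ _ _ e h k
      exact EX_equiv e (h k)
    · intro n K C K' _ _ _ _ _ _ i p h hC hK' k
      refine h.descend ?_ (EX_of_injective hC ?_) (hK' (k + 1))
      · rw [← Matrix.transpose_mul, (hsp _).1, Matrix.transpose_zero]
      · rw [Matrix.transpose_transpose, Matrix.transpose_transpose]
        exact (hsp k).2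
  · obtain ⟨e, j, hej, hj⟩ := he n
    have hz : A (n + 1) * A (n + 2) = 0 := (EX_of_range (hA (n + 1))).1
    refine ⟨fun l => A (n + 1) j l, ?_, ?_⟩
    · change act (A (n + 2))ᵀ R (fun l => A (n + 1) j l) = 0
      ext i
      have := congrFun (congrFun hz j) i
      rw [Matrix.mul_apply] at this
      rw [act_apply]
      simp only [Matrix.transpose_apply, smul_eq_mul]
      refine Eq.trans ?_ this
      exact Finset.sum_congr rfl fun _ _ => mul_comm _ _
    · intro a ha
      have hek : e ∈ LinearMap.ker (act (A n) R) := hej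
      rw [← hA] at hek
      obtain ⟨y, hy⟩ := hek
      have h1 : a * e j = 0 := by
        rw [← hy, act_apply, Finset.mul_sum]
        refine Finset.sum_eq_zero fun l _ => ?_
        have h2 : a * A (n + 1) j l = 0 := congrFun ha l
        rw [smul_eq_mul, ← mul_assoc, h2, zero_mul]
      rwa [hj, mul_one] at h1
  · intro hP
    change Module.Projective R ((Fin (r (n + 2)) → R) ⧸ LinearMap.range (act (A (n + 2))ᵀᵀ R)) at hP
    rw [Matrix.transpose_transpose] at hP
    have key : ∀ i, (∃ m, HasProjectiveDimensionLT (ModuleCat.of R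
        ((Fin (r i) → R) ⧸ LinearMap.range (act (A i) R))) (m + 1)) →
        ∃ m, HasProjectiveDimensionLT (ModuleCat.of R
        ((Fin (r 0) → R) ⧸ LinearMap.range (act (A 0) R))) (m + 1) := by
      intro i
      induction i with
      | zero => exact id
      | succ i ih =>
        rintro ⟨m, hm⟩
        refine ih ⟨m + 1, hasPD_step (SES.ofSub _) m (hasPD_equiv ?_ _ hm)⟩
        exact (Submodule.quotEquivOfEq _ _ (hA i)).trans (LinearMap.quotKerEquivRange _)
    obtain ⟨m, hm⟩ := key (n + 2) ⟨0, by
      have := (IsProjective.iff_projective _).mp hP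
      infer_instance⟩
    refine ⟨m + 1, hasPD_equiv ?_ _ hm⟩
    revert hA0
    generalize act (A 0) R = ff
    intro hA0
    refine (Submodule.quotEquivOfEq _ _ ?_).trans (LinearMap.quotKerEquivOfSurjective
      (((IsLocalRing.maximalIdeal R).mkQ ∘ₗ LinearMap.proj 0) ∘ₗ
        LinearMap.funLeft R R (Fin.cast hr0.symm)) ?_)
    · rw [hA0]; rfl
    · intro y
      obtain ⟨z, rfl⟩ := Submodule.mkQ_surjective _ y
      exact ⟨fun _ => z, rfl⟩

end Res

end GGP

set_option linter.unusedSectionVars false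

namespace GGP

open CategoryTheory IsLocalRing
open scoped Pointwise

section Serre

theorem hasPD_sub {R : Type u} [CommRing R] {K C K' : Type u} [AddCommGroup K] [Module R K]
    [AddCommGroup C]
    [Module R C] [AddCommGroup K'] [Module R K'] {i : K →ₗ[R] C} {p : C →ₗ[R] K'}
    (h : SES i p) [Module.Projective R C] (n : ℕ)
    (hK : HasProjectiveDimensionLT (ModuleCat.of R K') (n + 2)) :
    HasProjectiveDimensionLT (ModuleCat.of R K) (n + 1) :=
  (h.shortExact.hasProjectiveDimensionLT_X₃_iff n
    (IsProjective.iff_projective C |>.mp inferInstance)).mp hK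

theorem SES.ofSurj {R : Type u} [CommRing R] {C K' : Type u} [AddCommGroup C]
    [Module R C] [AddCommGroup K'] [Module R K'] {p : C →ₗ[R] K'} (h : Function.Surjective p) :
    SES (LinearMap.ker p).subtype p where
  inj := Subtype.val_injective
  surj := h
  zero := fun x => x.2
  exact := fun y hy => ⟨⟨y, hy⟩, rfl⟩

variable {R : Type u} [CommRing R] [IsLocalRing R] [IsNoetherianRing R]

theorem free_of_socle (j : ResidueField R →ₗ[R] R) (hj : Function.Injective j) (n : ℕ)
    (N : Type u) [AddCommGroup N] [Module R N] [Module.Finite R N]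
    (hN : HasProjectiveDimensionLT (ModuleCat.of R N) (n + 1)) : Module.Free R N := by
  induction n generalizing N with
  | zero =>
    have : Projective (ModuleCat.of R N) := projective_iff_hasProjectiveDimensionLT_one.mpr hN
    have : Module.Projective R N := (IsProjective.iff_projective N).mpr this
    exact Module.free_of_flat_of_isLocalRing
  | succ n ih =>
    obtain ⟨r, p, hp⟩ := Module.Finite.exists_fin' R N
    have hK : Module.Free R (LinearMap.ker p) := ih _ (hasPD_sub (SES.ofSurj hp) n hN)
    refine Module.free_of_lTensor_residueField_injective (LinearMap.ker p).subtype p hp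
      (LinearMap.exact_subtype_ker_map p) ?_
    have h1 : Function.Injective (j.rTensor (LinearMap.ker p)) :=
      Module.Flat.rTensor_preserves_injective_linearMap _ hj
    have h2 : Function.Injective ((LinearMap.ker p).subtype.lTensor R) :=
      Module.Flat.lTensor_preserves_injective_linearMap _ Subtype.val_injective
    have h3 : Function.Injective (((LinearMap.ker p).subtype.lTensor R) ∘ₗ
      (j.rTensor (LinearMap.ker p))) := h2.comp h1
    rw [LinearMap.lTensor_comp_rTensor, ← LinearMap.rTensor_comp_lTensor] at h3
    exact Function.Injective.of_comp h3

theorem hasPD_quot {x : R} (hx : IsSMulRegular R x) (n : ℕ)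
    (N : Type u) [AddCommGroup N] [Module R N] [Module.Finite R N] (hxN : IsSMulRegular N x)
    (hN : HasProjectiveDimensionLT (ModuleCat.of R N) (n + 1)) :
    HasProjectiveDimensionLT (ModuleCat.of (R ⧸ Ideal.span {x}) (QuotSMulTop x N)) (n + 1) := by
  induction n generalizing N with
  | zero =>
    have : Projective (ModuleCat.of R N) := projective_iff_hasProjectiveDimensionLT_one.mpr hN
    have : Module.Projective R N := (IsProjective.iff_projective N).mpr this
    have : Module.Free R N := Module.free_of_flat_of_isLocalRing
    have := (IsProjective.iff_projective (R := R ⧸ Ideal.span {x}) (QuotSMulTop x N)).mp inferInstance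
    infer_instance
  | succ n ih =>
    obtain ⟨r, p, hp⟩ := Module.Finite.exists_fin' R N
    have hFreg : IsSMulRegular (Fin r → R) x := by
      intro a b hab
      ext i
      exact hx (congrFun hab i)
    have hKreg : IsSMulRegular (LinearMap.ker p) x := by
      intro a b hab
      exact Subtype.ext (hFreg (congrArg Subtype.val hab))
    have hK := ih (LinearMap.ker p) hKreg (hasPD_sub (SES.ofSurj hp) n hN)
    have hs : Function.Surjective (algebraMap R (R ⧸ Ideal.span {x})) :=
      Ideal.Quotient.mk_surjective
    refine hasPD_step (i := (QuotSMulTop.map x (LinearMap.ker p).subtype).extendScalarsOfSurjective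
      hs) (p := (QuotSMulTop.map x p).extendScalarsOfSurjective hs) ?_ n hK
    constructor
    · rw [injective_iff_map_eq_zero]
      intro a ha
      obtain ⟨a, rfl⟩ := Submodule.mkQ_surjective _ a
      change Submodule.Quotient.mk (a : Fin r → R) = 0 at ha
      rw [Submodule.Quotient.mk_eq_zero] at ha
      obtain ⟨b, -, hb⟩ := ha
      change x • b = a at hb
      have hb0 : p b = 0 := by
        apply hxN
        change x • p b = x • 0
        rw [smul_zero, ← map_smul, hb]
        exact a.2
      change Submodule.Quotient.mk a = 0
      rw [Submodule.Quotient.mk_eq_zero]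
      exact ⟨⟨b, hb0⟩, trivial, Subtype.ext hb⟩
    · intro y
      obtain ⟨y, rfl⟩ := Submodule.mkQ_surjective _ y
      obtain ⟨z, rfl⟩ := hp y
      exact ⟨Submodule.Quotient.mk z, rfl⟩
    · intro y
      obtain ⟨y, rfl⟩ := Submodule.mkQ_surjective _ y
      change Submodule.Quotient.mk (p y.1) = 0
      rw [y.2]
      rfl
    · intro y hy
      obtain ⟨y, rfl⟩ := Submodule.mkQ_surjective _ y
      change Submodule.Quotient.mk (p y) = 0 at hy
      rw [Submodule.Quotient.mk_eq_zero] at hy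
      obtain ⟨b, -, hb⟩ := hy
      obtain ⟨c, rfl⟩ := hp b
      change x • p c = p y at hb
      refine ⟨Submodule.Quotient.mk ⟨y - x • c, by simp [hb]⟩, ?_⟩
      change Submodule.Quotient.mk (y - x • c) = Submodule.Quotient.mk y
      rw [Submodule.Quotient.eq]
      exact ⟨-c, trivial, by simp⟩

theorem retract_aux {R S Q : Type u} [CommRing R] [CommRing S] [Algebra R S]
    (hs : Function.Surjective (algebraMap R S)) (m : Ideal R) (m' : Ideal S)
    (hm : ∀ r, algebraMap R S r ∈ m' ↔ r ∈ m) [AddCommGroup Q] [Module R Q] [Module S Q]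
    [IsScalarTower R S Q] (q : Q) (hq : ∀ r ∈ m, r • q = 0) (f : Q →ₗ[R] R ⧸ m)
    (hf : f q = Submodule.Quotient.mk 1) :
    ∃ (i : (S ⧸ m') →ₗ[S] Q) (p : Q →ₗ[S] (S ⧸ m')), p ∘ₗ i = LinearMap.id := by
  let g0 : (R ⧸ m) →ₗ[R] (S ⧸ m') :=
    m.liftQ ((m'.mkQ.restrictScalars R) ∘ₗ Algebra.linearMap R S) (by
        intro r hr
        rw [LinearMap.mem_ker]
        change Submodule.Quotient.mk (algebraMap R S r) = _
        rw [Submodule.Quotient.mk_eq_zero, hm]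
        exact hr)
  let i : (S ⧸ m') →ₗ[S] Q :=
    m'.liftQ (LinearMap.toSpanSingleton S Q q) (by
        intro r' hr'
        obtain ⟨r, rfl⟩ := hs r'
        rw [hm] at hr'
        rw [LinearMap.mem_ker, LinearMap.toSpanSingleton_apply, algebraMap_smul, hq r hr'])
  refine ⟨i, (g0 ∘ₗ f).extendScalarsOfSurjective hs, ?_⟩
  refine Submodule.linearMap_qext _ ?_
  ext
  have h1 : i (Submodule.Quotient.mk 1) = q := by
    change LinearMap.toSpanSingleton S Q q 1 = q
    simp
  change g0 (f (i (Submodule.Quotient.mk 1))) = Submodule.Quotient.mk 1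
  rw [h1, hf]
  change Submodule.Quotient.mk (algebraMap R S 1) = _
  rw [map_one]

theorem exists_functional {x : R} (hxm : x ∈ maximalIdeal R)
    (hx2 : x ∉ maximalIdeal R ^ 2) : ∃ f : maximalIdeal R →ₗ[R] R ⧸ maximalIdeal R,
      f ⟨x, hxm⟩ = Submodule.Quotient.mk 1 := by
  have hne : (maximalIdeal R).toCotangent ⟨x, hxm⟩ ≠ 0 := by
    rw [Ne, Ideal.toCotangent_eq_zero]
    exact hx2
  obtain ⟨f, hf⟩ := Module.Projective.exists_dual_eq_one (ResidueField R)
    (V := CotangentSpace R) hne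
  exact ⟨(f.restrictScalars R) ∘ₗ (maximalIdeal R).toCotangent, hf⟩

theorem map_max_iff {S : Type u} [CommRing S] [IsLocalRing S] [Algebra R S]
    (hs : Function.Surjective (algebraMap R S)) (r : R) :
    algebraMap R S r ∈ maximalIdeal S ↔ r ∈ maximalIdeal R := by
  have : IsLocalHom (algebraMap R S) := IsLocalHom.of_surjective _ hs
  simp

theorem hasPD_residue_quot {x : R} (hx : IsSMulRegular R x) (hxm : x ∈ maximalIdeal R)
    (hx2 : x ∉ maximalIdeal R ^ 2) [IsLocalRing (R ⧸ Ideal.span {x})] (n : ℕ)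
    (h : HasProjectiveDimensionLT (ModuleCat.of R (ResidueField R)) (n + 2)) :
    HasProjectiveDimensionLT (ModuleCat.of (R ⧸ Ideal.span {x})
      (ResidueField (R ⧸ Ideal.span {x}))) (n + 1) := by
  have hm : HasProjectiveDimensionLT (ModuleCat.of R (maximalIdeal R)) (n + 1) :=
    hasPD_sub (SES.ofSub (maximalIdeal R)) n h
  have hq := hasPD_quot hx n (maximalIdeal R) (by
    intro a b hab
    exact Subtype.ext (hx (congrArg Subtype.val hab))) hm
  have hs : Function.Surjective (algebraMap R (R ⧸ Ideal.span {x})) :=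
    Ideal.Quotient.mk_surjective
  obtain ⟨f, hf⟩ := exists_functional hxm hx2
  obtain ⟨i, p, hip⟩ := retract_aux hs (maximalIdeal R) (maximalIdeal (R ⧸ Ideal.span {x}))
    (map_max_iff hs) (Q := QuotSMulTop x (maximalIdeal R)) (Submodule.Quotient.mk ⟨x, hxm⟩) (by
      intro r hr
      rw [← Submodule.Quotient.mk_smul, Submodule.Quotient.mk_eq_zero]
      exact ⟨⟨r, hr⟩, trivial, Subtype.ext (mul_comm _ _)⟩)
    (Submodule.liftQ _ f (by
      rintro _ ⟨b, -, rfl⟩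
      change f (x • b) = 0
      rw [map_smul]
      obtain ⟨z, hz⟩ := Submodule.mkQ_surjective _ (f b)
      rw [← hz, ← map_smul, Submodule.mkQ_apply, Submodule.Quotient.mk_eq_zero]
      exact Ideal.mul_mem_right _ _ hxm)) hf
  exact Retract.hasProjectiveDimensionLT (X := ModuleCat.of (R ⧸ Ideal.span {x})
    ((R ⧸ Ideal.span {x}) ⧸ maximalIdeal (R ⧸ Ideal.span {x})))
    (Y := ModuleCat.of (R ⧸ Ideal.span {x})
    (QuotSMulTop x (maximalIdeal R))) ⟨ModuleCat.ofHom i, ModuleCat.ofHom p, by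
      rw [← ModuleCat.ofHom_comp, ← ModuleCat.ofHom_id, hip]⟩ (n + 1)

theorem finset_of_card_le (s : Finset R) (hs : Ideal.span (s : Set R) = maximalIdeal R)
    (hd : (s.card : WithBot ℕ∞) ≤ ringKrullDim R) : GG.IsRegularLocal R := by
  refine ⟨inferInstance, s, hs, le_antisymm hd ?_⟩
  have h1 := ringKrullDim_le_spanFinrank_maximalIdeal R
  refine h1.trans ?_
  rw [← hs]
  have := Submodule.spanFinrank_span_le_ncard_of_finite (R := R) (s := (s : Set R)) s.finite_toSet
  rw [Set.ncard_coe_finset] at this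
  exact_mod_cast this

theorem lift_regular {x : R} (hx : IsSMulRegular R x) (hxm : x ∈ maximalIdeal R)
    [IsLocalRing (R ⧸ Ideal.span {x})] (h : GG.IsRegularLocal (R ⧸ Ideal.span {x})) :
    GG.IsRegularLocal R := by
  classical
  obtain ⟨-, s', hs', hc⟩ := h
  have hs : Function.Surjective (algebraMap R (R ⧸ Ideal.span {x})) :=
    Ideal.Quotient.mk_surjective
  have hdim := ringKrullDim_quotient_span_singleton_succ_eq_ringKrullDim_of_mem_jacobson hx
    (by rw [IsLocalRing.ringJacobson_eq_maximalIdeal]; exact hxm)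
  have hs2 := hs
  choose g hg using hs2
  refine finset_of_card_le (insert x (s'.image g)) ?_ ?_
  · apply le_antisymm
    · rw [Ideal.span_le]
      intro y hy
      rw [Finset.coe_insert, Finset.coe_image] at hy
      rcases hy with rfl | ⟨z, hz, rfl⟩
      · exact hxm
      · change g z ∈ maximalIdeal R
        rw [← map_max_iff hs, hg, ← hs']
        exact Ideal.subset_span hz
    · intro y hy
      have h1 : algebraMap R (R ⧸ Ideal.span {x}) y ∈ Ideal.map (algebraMap R (R ⧸ Ideal.span {x}))
          (Ideal.span (g '' (s' : Set (R ⧸ Ideal.span {x})))) := by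
        have h2 : (algebraMap R (R ⧸ Ideal.span {x})) '' (g '' (s' : Set (R ⧸ Ideal.span {x})))
            = s' := by
          rw [← Set.image_comp]
          have : (algebraMap R (R ⧸ Ideal.span {x})) ∘ g = id := funext hg
          rw [this, Set.image_id]
        rw [Ideal.map_span, h2, hs', map_max_iff hs]
        exact hy
      rw [Ideal.mem_map_iff_of_surjective _ hs] at h1
      obtain ⟨z, hz, hzy⟩ := h1
      have h3 : y - z ∈ Ideal.span {x} := by
        rw [← Ideal.Quotient.eq]
        exact hzy.symm
      have : y = (y - z) + z := by ring
      rw [this]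
      refine Ideal.add_mem _ (Ideal.span_mono ?_ h3) (Ideal.span_mono ?_ hz)
      · simp
      · simp
  · rw [← hdim, ← hc]
    have := (Finset.card_insert_le x (s'.image g)).trans
      (Nat.add_le_add_right (Finset.card_image_le (s := s') (f := g)) 1)
    exact_mod_cast this

theorem regular_of_bot (h : maximalIdeal R = ⊥) : GG.IsRegularLocal R := by
  refine finset_of_card_le ∅ (by simp [h]) ?_
  simpa using ringKrullDim_nonneg_of_nontrivial

theorem exists_x (h0 : maximalIdeal R ≠ ⊥) (hA : maximalIdeal R ∉ associatedPrimes R R) :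
    ∃ x ∈ maximalIdeal R, x ∉ maximalIdeal R ^ 2 ∧ IsSMulRegular R x := by
  classical
  by_contra hcon
  push Not at hcon
  have hfin := associatedPrimes.finite R R
  have hsub : (maximalIdeal R : Set R) ⊆ (maximalIdeal R ^ 2 : Ideal R) ∪
      (maximalIdeal R ^ 2 : Ideal R) ∪ ⋃ i ∈ (↑(insert (maximalIdeal R ^ 2) hfin.toFinset \
        {maximalIdeal R ^ 2}) : Set (Ideal R)), (id i : Ideal R) := by
    intro x hx
    by_cases hx2 : x ∈ maximalIdeal R ^ 2
    · exact Or.inl (Or.inl hx2)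
    · right
      have hnr := hcon x hx hx2
      have hz : x ∈ ⋃ p ∈ associatedPrimes R R, (p : Set R) := by
        rw [biUnion_associatedPrimes_eq_zero_divisors]
        by_contra hno
        apply hnr
        intro a b hab
        by_contra hne
        exact hno ⟨a - b, sub_ne_zero.mpr hne, by
          change x • a = x • b at hab
          simp only [smul_eq_mul] at hab ⊢
          rw [mul_sub, hab, sub_self]⟩
      simp only [Set.mem_iUnion] at hz ⊢
      obtain ⟨p, hp, hxp⟩ := hz
      refine ⟨p, ?_, hxp⟩
      simp only [Finset.coe_sdiff, Finset.coe_insert, Set.Finite.coe_toFinset,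
        Finset.coe_singleton]
      refine ⟨Or.inr hp, ?_⟩
      rintro rfl
      exact hx2 hxp
  have hsub2 : ∀ hp, _ := fun hp =>
    (Ideal.subset_union_prime' (f := (id : Ideal R → Ideal R)) (a := maximalIdeal R ^ 2)
      (b := maximalIdeal R ^ 2) hp).mp hsub
  have hsub := hsub2 ?_
  · have hle : maximalIdeal R ≤ maximalIdeal R ^ 2 → False := by
      intro hle
      apply h0
      refine Submodule.eq_bot_of_le_smul_of_le_jacobson_bot (maximalIdeal R) (maximalIdeal R)
        (IsNoetherian.noetherian _) ?_ (maximalIdeal_le_jacobson _)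
      rw [smul_eq_mul, ← sq]
      exact hle
    rcases hsub with h | h | ⟨p, hp, h⟩
    · exact hle h
    · exact hle h
    · simp only [Finset.mem_sdiff, Finset.mem_insert, Finset.mem_singleton,
        Set.Finite.mem_toFinset] at hp
      have hpa : p ∈ associatedPrimes R R := by tauto
      have := (maximalIdeal.isMaximal R).eq_of_le hpa.isPrime.ne_top h
      exact hA (this ▸ hpa)
  · intro p hp
    simp only [Finset.mem_sdiff, Finset.mem_insert, Finset.mem_singleton,
        Set.Finite.mem_toFinset] at hp
    have hpa : p ∈ associatedPrimes R R := by tauto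
    exact hpa.isPrime

theorem bot_of_ass (hA : maximalIdeal R ∈ associatedPrimes R R) (n : ℕ)
    (hn : HasProjectiveDimensionLT (ModuleCat.of R (ResidueField R)) (n + 1)) :
    maximalIdeal R = ⊥ := by
  rw [AssociatedPrimes.mem_iff, isAssociatedPrime_iff] at hA
  obtain ⟨-, a, ha⟩ := hA
  have hker : ∀ r, r ∈ maximalIdeal R ↔ r • a = 0 := by
    intro r
    rw [ha, Submodule.mem_colon_singleton]
    rfl
  let j : (R ⧸ maximalIdeal R) →ₗ[R] R := (maximalIdeal R).liftQ (LinearMap.toSpanSingleton R R a)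
    (fun r hr => by simpa using (hker r).mp hr)
  have hj : Function.Injective j := by
    rw [injective_iff_map_eq_zero]
    intro y hy
    obtain ⟨z, rfl⟩ := Submodule.mkQ_surjective _ y
    rw [Submodule.mkQ_apply, Submodule.Quotient.mk_eq_zero, hker]
    exact hy
  have hfree : Module.Free R (R ⧸ maximalIdeal R) := free_of_socle j hj n _ hn
  rw [eq_bot_iff]
  intro r hr
  have hb := Module.Free.chooseBasis R (R ⧸ maximalIdeal R)
  have hne : (Submodule.Quotient.mk 1 : R ⧸ maximalIdeal R) ≠ 0 := by
    rw [Ne, Submodule.Quotient.mk_eq_zero]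
    exact fun h => (Ideal.ne_top_iff_one _).mp (maximalIdeal.isMaximal R).ne_top h
  have hNt : Nontrivial (R ⧸ maximalIdeal R) := ⟨⟨_, _, hne⟩⟩
  obtain ⟨i⟩ := hb.index_nonempty
  have h1 : r • hb i = 0 := by
    obtain ⟨z, hz⟩ := Submodule.mkQ_surjective _ (hb i)
    rw [← hz, ← map_smul, Submodule.mkQ_apply, Submodule.Quotient.mk_eq_zero]
    exact Ideal.mul_mem_right _ _ hr
  have h2 := congrArg (fun y => hb.repr y i) h1
  simpa using h2

theorem serre (d : ℕ) : ∀ (R : Type u) [CommRing R] [IsLocalRing R] [IsNoetherianRing R],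
    ringKrullDim R < d → ∀ n, HasProjectiveDimensionLT (ModuleCat.of R (ResidueField R)) n →
    GG.IsRegularLocal R := by
  induction d with
  | zero =>
    intro R _ _ _ hd n hn
    exact absurd (hd.trans_le (ringKrullDim_nonneg_of_nontrivial)) (lt_irrefl _)
  | succ d ih =>
    intro R _ _ _ hd n hn
    by_cases h0 : maximalIdeal R = ⊥
    · exact regular_of_bot h0
    have hn2 : HasProjectiveDimensionLT (ModuleCat.of R (ResidueField R)) (n + 2) :=
      hasProjectiveDimensionLT_of_ge _ n (n + 2) (by omega)
    by_cases hA : maximalIdeal R ∈ associatedPrimes R R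
    · exact absurd (bot_of_ass hA (n + 1) hn2) h0
    obtain ⟨x, hxm, hx2, hx⟩ := exists_x h0 hA
    have : Nontrivial (R ⧸ Ideal.span {x}) := by
      rw [Ideal.Quotient.nontrivial_iff, Ne, Ideal.span_singleton_eq_top]
      exact hxm
    have : IsLocalRing (R ⧸ Ideal.span {x}) :=
      IsLocalRing.of_surjective' (Ideal.Quotient.mk _) Ideal.Quotient.mk_surjective
    have hdim := ringKrullDim_quotient_span_singleton_succ_eq_ringKrullDim_of_mem_jacobson hx
      (by rw [IsLocalRing.ringJacobson_eq_maximalIdeal]; exact hxm)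
    refine lift_regular hx hxm (ih _ ?_ (n + 1) (hasPD_residue_quot hx hxm hx2 n hn2))
    rw [← hdim, Nat.cast_add, Nat.cast_one] at hd
    exact lt_of_add_lt_add_right hd

theorem serre_fin {n : ℕ} (hn : HasProjectiveDimensionLT (ModuleCat.of R (ResidueField R)) n) :
    GG.IsRegularLocal R := by
  have h := ringKrullDim_le_spanFinrank_maximalIdeal R
  refine serre ((maximalIdeal R).spanFinrank + 1) R (lt_of_le_of_lt h ?_) n hn
  exact_mod_cast Nat.lt_succ_self _

end Serre

end GGP

set_option linter.unusedSectionVars false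

namespace GGP

open CategoryTheory Abelian IsLocalRing
open scoped Pointwise

section ExtV

variable (R : Type u) [CommRing R]

/-- Vanishing of `Ext^i(N, L)`. -/
def EV (N L : Type u) [AddCommGroup N] [Module R N] [AddCommGroup L] [Module R L] (i : ℕ) : Prop :=
  Subsingleton (Ext (ModuleCat.of R N) (ModuleCat.of R L) i)

variable {R}

theorem EV.iff {N L : Type u} [AddCommGroup N] [Module R N] [AddCommGroup L] [Module R L] {i : ℕ} :
    EV R N L i ↔ ∀ x : Ext (ModuleCat.of R N) (ModuleCat.of R L) i, x = 0 :=
  ⟨fun h x => @Subsingleton.elim _ h x 0, fun h => ⟨fun x y => (h x).trans (h y).symm⟩⟩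

theorem EV.congr {N L N' L' : Type u} [AddCommGroup N] [Module R N] [AddCommGroup L] [Module R L]
    [AddCommGroup N'] [Module R N'] [AddCommGroup L'] [Module R L']
    (e : N ≃ₗ[R] N') (e' : L ≃ₗ[R] L') {i : ℕ} (h : EV R N L i) : EV R N' L' i := by
  rw [EV.iff] at h ⊢
  intro x
  have key : ∀ {A A' B B' : ModuleCat.{u} R} (a : A ≅ A') (b : B ≅ B')
      (_ : ∀ x : Ext A B i, x = 0) (x : Ext A' B' i), x = 0 := by
    intro A A' B B' a b h x
    have h1 := h (((Ext.mk₀ a.hom).comp x (zero_add i)).comp (Ext.mk₀ b.inv) (add_zero i))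
    have h2 := congrArg (fun y => ((Ext.mk₀ a.inv).comp y (zero_add i)).comp
      (Ext.mk₀ b.hom) (add_zero i)) h1
    simpa using h2
  exact key e.toModuleIso e'.toModuleIso h x

theorem EV.zero_iff {N L : Type u} [AddCommGroup N] [Module R N] [AddCommGroup L] [Module R L] :
    EV R N L 0 ↔ ∀ f : N →ₗ[R] L, f = 0 := by
  have : EV R N L 0 ↔ Subsingleton (N →ₗ[R] L) := by
    unfold EV
    rw [Ext.addEquiv₀.subsingleton_congr, ModuleCat.homAddEquiv.subsingleton_congr]
  rw [this]
  exact ⟨fun h f => Subsingleton.elim _ _, fun h => ⟨fun f g => (h f).trans (h g).symm⟩⟩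

theorem EV.of_injective {N L : Type u} [AddCommGroup N] [Module R N] [AddCommGroup L] [Module R L]
    (hL : Module.Injective R L) (i : ℕ) : EV R N L (i + 1) := by
  have := (Module.injective_iff_injective_object R L).mp hL
  exact ⟨fun x y => (x.eq_zero_of_injective).trans (y.eq_zero_of_injective).symm⟩

theorem EV.of_subsingleton {N L : Type u} [AddCommGroup N] [Module R N] [AddCommGroup L]
    [Module R L] [Subsingleton L] (i : ℕ) : EV R N L i := by
  rw [EV.iff]
  intro x
  have : (𝟙 (ModuleCat.of R L)) = 0 := (ModuleCat.isZero_of_subsingleton _).eq_of_src _ _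
  rw [← x.comp_mk₀_id, this, Ext.mk₀_zero, Ext.comp_zero]

theorem EV.of_subsingleton_left {N L : Type u} [AddCommGroup N] [Module R N] [AddCommGroup L]
    [Module R L] [Subsingleton N] (i : ℕ) : EV R N L i := by
  rw [EV.iff]
  intro x
  have : (𝟙 (ModuleCat.of R N)) = 0 := (ModuleCat.isZero_of_subsingleton _).eq_of_src _ _
  rw [← x.mk₀_id_comp, this, Ext.mk₀_zero, Ext.zero_comp]

variable {K C K' : Type u} [AddCommGroup K] [Module R K] [AddCommGroup C] [Module R C]
    [AddCommGroup K'] [Module R K'] {i : K →ₗ[R] C} {p : C →ₗ[R] K'}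

theorem SES.ev_left (h : SES i p) {L : Type u} [AddCommGroup L] [Module R L] {n : ℕ}
    (h2 : EV R C L n) (h3 : EV R K' L (n + 1)) : EV R K L n := by
  rw [EV.iff] at h2 h3 ⊢
  intro x
  obtain ⟨y, hy⟩ := Ext.contravariant_sequence_exact₁ h.shortExact _ x (add_comm 1 n) (h3 _)
  rw [← hy, h2 y, Ext.comp_zero]

theorem SES.ev_mid (h : SES i p) {L : Type u} [AddCommGroup L] [Module R L] {n : ℕ}
    (h1 : EV R K L n) (h3 : EV R K' L n) : EV R C L n := by
  rw [EV.iff] at h1 h3 ⊢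
  intro x
  obtain ⟨y, hy⟩ := Ext.contravariant_sequence_exact₂ h.shortExact _ x (h1 _)
  rw [← hy, h3 y, Ext.comp_zero]

theorem SES.ev_cov_right (h : SES i p) {N : Type u} [AddCommGroup N] [Module R N] {n : ℕ}
    (h2 : EV R N C n) (h1 : EV R N K (n + 1)) : EV R N K' n := by
  rw [EV.iff] at h1 h2 ⊢
  intro x
  obtain ⟨y, hy⟩ := Ext.covariant_sequence_exact₃ _ h.shortExact x rfl (h1 _)
  rw [← hy, h2 y, Ext.zero_comp]

theorem SES.ev_cov_left (h : SES i p) {N : Type u} [AddCommGroup N] [Module R N] {n : ℕ}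
    (h3 : EV R N K' n) (h2 : EV R N C (n + 1)) : EV R N K (n + 1) := by
  rw [EV.iff] at h3 h2 ⊢
  intro x
  obtain ⟨y, hy⟩ := Ext.covariant_sequence_exact₁ _ h.shortExact x (h2 _) rfl
  rw [← hy, h3 y, Ext.zero_comp]

theorem ev_nakayama [IsLocalRing R] [IsNoetherianRing R] {y : R} (hy : y ∈ maximalIdeal R)
    {p : K →ₗ[R] K'} (h : SES (y • (LinearMap.id : K →ₗ[R] K)) p) {L : Type u} [AddCommGroup L]
    [Module R L] [Module.Finite R K] [Module.Finite R L] {n : ℕ}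
    (h3 : EV R K' L (n + 1)) : EV R K L n := by
  have hx : ∀ x : Ext (ModuleCat.of R K) (ModuleCat.of R L) n,
      ∃ z : Ext (ModuleCat.of R K) (ModuleCat.of R L) n, y • z = x := by
    intro x
    rw [EV.iff] at h3
    obtain ⟨z, hz⟩ := Ext.contravariant_sequence_exact₁ h.shortExact _ x (add_comm 1 n) (h3 _)
    refine ⟨z, ?_⟩
    have : (ModuleCat.ofHom (y • (LinearMap.id : K →ₗ[R] K))) = y • 𝟙 (ModuleCat.of R K) := rfl
    change (Ext.mk₀ (ModuleCat.ofHom (y • (LinearMap.id : K →ₗ[R] K)))).comp z _ = x at hz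
    rw [this, Ext.mk₀_smul, Ext.smul_comp, Ext.mk₀_id_comp] at hz
    exact hz
  have hf : Module.Finite R (Ext (ModuleCat.of R K) (ModuleCat.of R L) n) := inferInstance
  have : (⊤ : Submodule R (Ext (ModuleCat.of R K) (ModuleCat.of R L) n)) = ⊥ := by
    refine Submodule.eq_bot_of_le_smul_of_le_jacobson_bot (maximalIdeal R) ⊤ hf.fg_top ?_
      (maximalIdeal_le_jacobson _)
    intro x _
    obtain ⟨z, rfl⟩ := hx x
    exact Submodule.smul_mem_smul hy trivial
  rw [EV.iff]
  intro x
  have hx : x ∈ (⊤ : Submodule R (Ext (ModuleCat.of R K) (ModuleCat.of R L) n)) := trivial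
  rw [this] at hx
  exact hx

theorem ev_of_idLE {L : Type u} [AddCommGroup L] [Module R L] (n : ℕ) (h : GG.idLE R L n) :
    HasInjectiveDimensionLE (ModuleCat.of R L) n := by
  have := dim_shift (R := R) (fun m L => ∀ i, m ≤ i → ∀ (N : Type u) [AddCommGroup N]
    [Module R N], EV R N L i) ?_ ?_ ?_ L n h (n + 1) (by omega)
  · refine HasInjectiveDimensionLT.mk (n := n + 1) ?_
    intro i hi Y e
    exact EV.iff.mp (this i hi Y) e
  · intro i L _ _ _ j _ N _ _
    exact EV.of_subsingleton _
  · intro i L L' _ _ _ _ e h j hj N _ _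
    exact (h j hj N).congr (LinearEquiv.refl R N) e
  · intro n K C K' _ _ _ _ _ _ i p hs hC h j hj N _ _
    obtain ⟨j, rfl⟩ := Nat.exists_eq_add_of_le' (show 1 ≤ j by omega)
    exact hs.ev_cov_left (h j (by omega) N) (EV.of_injective hC j)

end ExtV
end GGP

set_option linter.unusedSectionVars false

namespace GGP

open CategoryTheory Abelian IsLocalRing RingTheory.Sequence
open scoped Pointwise

section Loc

variable {A : Type u} [CommRing A] [IsLocalRing A] [IsNoetherianRing A]

theorem smul_lt (p : Ideal A) (hp : p ≠ ⊤) : p • (⊤ : Submodule A (ModuleCat.of A A)) < ⊤ := by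
  rw [lt_top_iff_ne_top]
  intro h
  apply hp
  have : p • (⊤ : Submodule A A) = ⊤ := h
  simpa using this

theorem supp_quot (p : Ideal A) :
    Module.support A (ModuleCat.of A (A ⧸ p)) = PrimeSpectrum.zeroLocus p := by
  rw [Module.support_eq_zeroLocus, Ideal.annihilator_quotient]

/-- Rees: from vanishing to regular sequences. -/
theorem rees1 (p : Ideal A) (hp : p ≠ ⊤) (n : ℕ) (h : ∀ i < n, EV A (A ⧸ p) A i) :
    ∃ rs : List A, rs.length = n ∧ (∀ r ∈ rs, r ∈ p) ∧ IsRegular A rs := by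
  obtain ⟨rs, h1, h2, h3⟩ := ModuleCat.exists_isRegular_of_exists_subsingleton_ext p n
    (ModuleCat.of A A) (smul_lt p hp) (ModuleCat.of A (A ⧸ p)) (supp_quot p) h
  exact ⟨rs, h1, h2, h3⟩

theorem rees2 (p : Ideal A) (hp : p ≠ ⊤) (rs : List A) (h1 : ∀ r ∈ rs, r ∈ p)
    (h2 : IsRegular A rs) (i : ℕ) (hi : i < rs.length) : EV A (A ⧸ p) A i :=
  ModuleCat.subsingleton_ext_of_exists_isRegular p (ModuleCat.of A (A ⧸ p))
    (supp_quot p).subset (ModuleCat.of A A) (smul_lt p hp) rs h1 h2 i hi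

theorem socle_inj {L : Type u} [AddCommGroup L] [Module A L] (h : ¬ EV A (A ⧸ maximalIdeal A) L 0) :
    ∃ f : (A ⧸ maximalIdeal A) →ₗ[A] L, Function.Injective f := by
  rw [EV.zero_iff] at h
  push Not at h
  obtain ⟨f, hf⟩ := h
  refine ⟨f, ?_⟩
  have : IsSimpleModule A (A ⧸ maximalIdeal A) :=
    isSimpleModule_iff_isCoatom.mpr (maximalIdeal.isMaximal A).out
  exact (LinearMap.injective_or_eq_zero f).resolve_right hf

theorem socle_of_max (rs : List A) (h1 : ∀ r ∈ rs, r ∈ maximalIdeal A) (h2 : IsRegular A rs)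
    (ht : ¬ EV A (A ⧸ maximalIdeal A) A rs.length) :
    ∃ f : (A ⧸ maximalIdeal A) →ₗ[A] (A ⧸ (Ideal.ofList rs • (⊤ : Submodule A A))),
      Function.Injective f := by
  apply socle_inj
  intro h0
  have hlt : maximalIdeal A • (⊤ : Submodule A (ModuleCat.of A
      (A ⧸ (Ideal.ofList rs • (⊤ : Submodule A A))))) < ⊤ := by
    rw [lt_top_iff_ne_top]
    intro h
    have hnt : Nontrivial (A ⧸ (Ideal.ofList rs • (⊤ : Submodule A A))) :=
      Submodule.Quotient.nontrivial_iff.mpr h2.2.symm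
    have h' : (⊤ : Submodule A (A ⧸ (Ideal.ofList rs • (⊤ : Submodule A A)))) = ⊥ :=
      Submodule.eq_bot_of_le_smul_of_le_jacobson_bot (maximalIdeal A) ⊤
        (IsNoetherian.noetherian _) h.ge (maximalIdeal_le_jacobson _)
    exact top_ne_bot h'
  obtain ⟨xs, hx1, hx2, hx3⟩ := ModuleCat.exists_isRegular_of_exists_subsingleton_ext
    (maximalIdeal A) 1 (ModuleCat.of A (A ⧸ (Ideal.ofList rs • (⊤ : Submodule A A)))) hlt
    (ModuleCat.of A (A ⧸ maximalIdeal A)) (supp_quot _) (by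
      intro i hi
      obtain rfl : i = 0 := by omega
      exact h0)
  have hm : ∀ r ∈ rs ++ xs, r ∈ maximalIdeal A := by
    intro r hr
    rcases List.mem_append.mp hr with h | h
    · exact h1 r h
    · exact hx2 r h
  apply ht
  refine rees2 _ (maximalIdeal.isMaximal A).ne_top (rs ++ xs) hm ?_ _ (by simp [hx1])
  rw [IsLocalRing.isRegular_iff_isWeaklyRegular_of_subset_maximalIdeal hm,
    isWeaklyRegular_append_iff]
  exact ⟨h2.1, hx3.1⟩

theorem pd_quot (rs : List A) (h1 : ∀ r ∈ rs, r ∈ maximalIdeal A) (h2 : IsRegular A rs)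
    (L : Type u) [AddCommGroup L] [Module A L] (i : ℕ) (hi : rs.length < i) :
    EV A (A ⧸ (Ideal.ofList rs • (⊤ : Submodule A A))) L i := by
  have h := ModuleCat.projectiveDimension_quotient_eq_add_length_of_isWeaklyRegular
    (ModuleCat.of A A) rs h2.1 h1
  have h0 : projectiveDimension (ModuleCat.of A A) ≤ (0 : ℕ) := by
    rw [projectiveDimension_le_iff]
    have : Projective (ModuleCat.of A A) :=
      (IsProjective.iff_projective _).mp inferInstance
    exact projective_iff_hasProjectiveDimensionLT_one.mp this
  have h3 : projectiveDimension (ModuleCat.of A (A ⧸ (Ideal.ofList rs • (⊤ : Submodule A A)))) ≤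
      (rs.length : ℕ) := by
    refine h.le.trans ?_
    calc _ ≤ ((0 : ℕ) : WithBot ℕ∞) + rs.length := by gcongr
      _ = _ := by simp
  rw [projectiveDimension_le_iff] at h3
  exact HasProjectiveDimensionLT.subsingleton _ (rs.length + 1) i (by omega) _

theorem ses_prime (p : Ideal A) [p.IsPrime] (y : A) (hy : y ∉ p) :
    SES (y • (LinearMap.id : (A ⧸ p) →ₗ[A] (A ⧸ p)))
      (LinearMap.range (y • (LinearMap.id : (A ⧸ p) →ₗ[A] (A ⧸ p)))).mkQ where
  inj := by
    rw [injective_iff_map_eq_zero]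
    intro a ha
    obtain ⟨a, rfl⟩ := Ideal.Quotient.mk_surjective a
    have : Ideal.Quotient.mk p (y * a) = 0 := ha
    rw [Ideal.Quotient.eq_zero_iff_mem] at this ⊢
    exact (Ideal.IsPrime.mem_or_mem ‹_› this).resolve_left hy
  surj := Submodule.mkQ_surjective _
  zero := fun x => by
    rw [← LinearMap.mem_ker, Submodule.ker_mkQ]
    exact ⟨x, rfl⟩
  exact := fun x hx => by
    rw [← LinearMap.mem_ker, Submodule.ker_mkQ] at hx
    exact hx

theorem ev_prime {i : ℕ} (h : ∀ (N : Type u) [AddCommGroup N] [Module A N] [Module.Finite A N],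
    EV A N A (i + 1)) (p : Ideal A) [hp : p.IsPrime] (hpm : p ≠ maximalIdeal A) :
    EV A (A ⧸ p) A i := by
  have : ∃ y ∈ maximalIdeal A, y ∉ p := by
    by_contra hcon
    push Not at hcon
    exact hpm (le_antisymm (le_maximalIdeal hp.ne_top) hcon)
  obtain ⟨y, hym, hyp⟩ := this
  exact ev_nakayama hym (ses_prime p y hyp) (h _)

theorem local_ext {n : ℕ} (hinj : HasInjectiveDimensionLE (ModuleCat.of A A) n) (i : ℕ)
    (hi : (i : WithBot ℕ∞) ≠ ringKrullDim A) : EV A (A ⧸ maximalIdeal A) A i := by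
  classical
  have hmt := (maximalIdeal.isMaximal A).ne_top
  have hex : ∃ i, ¬ EV A (A ⧸ maximalIdeal A) A i := by
    by_contra hcon
    push Not at hcon
    have hd : ringKrullDim A < ⊤ := ringKrullDim_lt_top
    have hle : ∀ n : ℕ, (n : WithBot ℕ∞) ≤ ringKrullDim A := by
      intro n
      obtain ⟨rs, h1, h2, h3⟩ := rees1 (maximalIdeal A) hmt n (fun i _ => hcon i)
      rw [← ringKrullDim_add_length_eq_ringKrullDim_of_isRegular rs h3, h1]
      have hne : Nontrivial (A ⧸ Ideal.ofList rs) := by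
        rw [Ideal.Quotient.nontrivial_iff]
        intro h
        apply hmt
        rw [eq_top_iff, ← h]
        exact Ideal.span_le.mpr h2
      exact le_add_of_nonneg_left ringKrullDim_nonneg_of_nontrivial
    obtain ⟨m, hm⟩ := WithBot.ne_bot_iff_exists.mp (ringKrullDim_ne_bot (R := A))
    rw [← hm] at hd hle
    have hm2 : m ≠ ⊤ := by
      rintro rfl
      exact lt_irrefl _ hd
    obtain ⟨k, rfl⟩ := ENat.ne_top_iff_exists.mp hm2
    have := hle (k + 1)
    have h2 : k + 1 ≤ k := by exact_mod_cast this
    omega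
  set t := Nat.find hex with htdef
  have ht : ¬ EV A (A ⧸ maximalIdeal A) A t := Nat.find_spec hex
  have hlt : ∀ i < t, EV A (A ⧸ maximalIdeal A) A i := fun i hi => by
    by_contra h
    exact Nat.find_min hex hi h
  obtain ⟨rs, hlen, hm, hreg⟩ := rees1 (maximalIdeal A) hmt t hlt
  obtain ⟨f, hf⟩ := socle_of_max rs hm hreg (by rwa [hlen])
  have hses : SES f (LinearMap.range f).mkQ := {
    inj := hf
    surj := Submodule.mkQ_surjective _
    zero := fun x => by
      rw [← LinearMap.mem_ker, Submodule.ker_mkQ]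
      exact ⟨x, rfl⟩
    exact := fun x hx => by
      rw [← LinearMap.mem_ker, Submodule.ker_mkQ] at hx
      exact hx }
  have Q : ∀ k i : ℕ, t < i → n + 1 ≤ i + k → ∀ (N : Type u) [AddCommGroup N] [Module A N]
      [Module.Finite A N], EV A N A i := by
    intro k
    induction k with
    | zero =>
      intro i _ hi N _ _ _
      exact HasInjectiveDimensionLT.subsingleton (ModuleCat.of A A) (n + 1) i hi _
    | succ k ih =>
      intro i hti hi N _ _ hN
      have ih' : ∀ (N : Type u) [AddCommGroup N] [Module A N] [Module.Finite A N],
        EV A N A (i + 1) := fun N _ _ _ => ih (i + 1) (by omega) (by omega) N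
      have hk : EV A (A ⧸ maximalIdeal A) A i :=
        hses.ev_left (pd_quot rs hm hreg A i (by omega)) (ih' _)
      induction hN using IsNoetherianRing.induction_on_isQuotientEquivQuotientPrime A with
      | subsingleton N => exact EV.of_subsingleton_left _
      | quotient N p f =>
        have hp := p.2
        by_cases hpm : p.asIdeal = maximalIdeal A
        · rw [hpm] at f
          exact hk.congr f.symm (LinearEquiv.refl A A)
        · exact (ev_prime ih' p.asIdeal hpm).congr f.symm (LinearEquiv.refl A A)
      | exact N₁ N₂ N₃ f g hf hg hfg h₁ h₃ =>
        exact SES.ev_mid (i := f) (p := g) ⟨hf, hg, fun x => hfg.apply_apply_eq_zero x,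
          fun y hy => (hfg y).mp hy⟩ h₁ h₃
  have hprime : ∀ p : Ideal A, p.IsPrime → Ideal.ofList rs ≤ p → p = maximalIdeal A := by
    intro p hp hle
    by_contra hpm
    have hrp : ∀ r ∈ rs, r ∈ p := fun r hr => hle (Ideal.subset_span hr)
    have h1 : ∀ i < t + 1, EV A (A ⧸ p) A i := by
      intro i hi
      rcases Nat.lt_succ_iff_lt_or_eq.mp hi with h | rfl
      · exact rees2 p hp.ne_top rs hrp hreg i (by omega)
      · exact ev_prime (fun N _ _ _ => Q (n + 1) _ (by omega) (by omega) N) p hpm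
    obtain ⟨rs', hl', hm', hr'⟩ := rees1 p hp.ne_top (t + 1) h1
    exact ht (rees2 _ hmt rs' (fun r hr => le_maximalIdeal hp.ne_top (hm' r hr)) hr' t (by omega))
  have hne : Nontrivial (A ⧸ Ideal.ofList rs) := by
    rw [Ideal.Quotient.nontrivial_iff]
    intro h
    apply hmt
    rw [eq_top_iff, ← h]
    exact Ideal.span_le.mpr hm
  have hd0 : ringKrullDim (A ⧸ Ideal.ofList rs) = 0 := by
    refine le_antisymm ?_ ringKrullDim_nonneg_of_nontrivial
    have : Ring.KrullDimLE 0 (A ⧸ Ideal.ofList rs) := by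
      rw [Ring.krullDimLE_zero_iff]
      intro J hJ
      have h1 := hprime (J.comap (Ideal.Quotient.mk _)) inferInstance (by
        intro x hx
        rw [Ideal.mem_comap, Ideal.Quotient.eq_zero_iff_mem.mpr hx]
        exact zero_mem _)
      have : (J.comap (Ideal.Quotient.mk (Ideal.ofList rs))).IsMaximal := by
        rw [h1]; exact maximalIdeal.isMaximal A
      exact Ideal.isMaximal_of_isIntegral_of_isMaximal_comap' _
        (RingHom.isIntegral_of_surjective _ Ideal.Quotient.mk_surjective) J this
    exact_mod_cast Ring.krullDimLE_iff.mp this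
  have hdt : ringKrullDim A = t := by
    rw [← ringKrullDim_add_length_eq_ringKrullDim_of_isRegular rs hreg, hd0, hlen, zero_add]
  have hit : i ≠ t := by
    rintro rfl
    exact hi hdt.symm
  rcases lt_or_gt_of_ne hit with h | h
  · exact hlt i h
  · exact Q (n + 1) i h (by omega) _

end Loc
end GGP

set_option linter.unusedSectionVars false

namespace GGP

open CategoryTheory Abelian IsLocalRing
open scoped Pointwise

section LocInj

variable {A : Type u} [CommRing A]

theorem ext_lift {B E : Type u} [AddCommGroup B] [Module A B] [AddCommGroup E] [Module A E]
    (P : Submodule A B) (h : EV A (B ⧸ P) E 1) (f : P →ₗ[A] E) :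
    ∃ g : B →ₗ[A] E, ∀ x : P, g x = f x := by
  rw [EV.iff] at h
  obtain ⟨y, hy⟩ := Ext.contravariant_sequence_exact₁ (SES.ofSub P).shortExact
    (ModuleCat.of A E) (Ext.mk₀ (ModuleCat.ofHom f)) (add_zero 1) (h _)
  obtain ⟨g, rfl⟩ := (Ext.mk₀_bijective _ _).2 y
  rw [Ext.mk₀_comp_mk₀] at hy
  have := (Ext.mk₀_bijective _ _).1 hy
  refine ⟨g.hom, fun x => ?_⟩
  exact congrArg (fun q => q.hom x) this

variable [IsLocalRing A] [IsNoetherianRing A]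

theorem ev_of_killed {E : Type u} [AddCommGroup E] [Module A E]
    (h1 : EV A (A ⧸ maximalIdeal A) E 1) (l : ℕ) (N : Type u) [AddCommGroup N] [Module A N]
    [hN : Module.Finite A N] (hk : ∀ a ∈ maximalIdeal A ^ l, ∀ x : N, a • x = 0) :
    EV A N E 1 := by
  induction hN using IsNoetherianRing.induction_on_isQuotientEquivQuotientPrime A with
  | subsingleton N => exact EV.of_subsingleton_left _
  | quotient N p f =>
    have hp := p.2
    have hpm : p.asIdeal = maximalIdeal A := by
      refine le_antisymm (le_maximalIdeal hp.ne_top) ?_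
      refine hp.le_of_pow_le (n := l) ?_
      intro a ha
      have h2 := hk a ha (f.symm (Ideal.Quotient.mk _ 1))
      rw [← map_smul, LinearEquiv.map_eq_zero_iff] at h2
      have h3 : Ideal.Quotient.mk p.asIdeal (a * 1) = 0 := h2
      rwa [mul_one, Ideal.Quotient.eq_zero_iff_mem] at h3
    rw [hpm] at f
    exact h1.congr f.symm (LinearEquiv.refl A E)
  | exact N₁ N₂ N₃ f g hf hg hfg h₁ h₃ =>
    refine SES.ev_mid (i := f) (p := g) ⟨hf, hg, fun x => hfg.apply_apply_eq_zero x,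
          fun y hy => (hfg y).mp hy⟩ (h₁ ?_) (h₃ ?_)
    · intro a ha x
      apply hf
      rw [map_smul, hk a ha, map_zero]
    · intro a ha x
      obtain ⟨x, rfl⟩ := hg x
      rw [← map_smul, hk a ha, map_zero]

theorem inj_of_torsion {E : Type u} [AddCommGroup E] [Module A E]
    (hE : ∀ e : E, ∃ k, ∀ a ∈ maximalIdeal A ^ k, a • e = 0)
    (h1 : EV A (A ⧸ maximalIdeal A) E 1) : Module.Injective A E := by
  classical
  apply Module.Baer.injective
  intro I f
  obtain ⟨s, hs⟩ : (⊤ : Submodule A I).FG := IsNoetherian.noetherian _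
  choose k hk using fun e => hE e
  set n := s.sup (fun x => k (f x)) with hn
  have hkill : ∀ a ∈ maximalIdeal A ^ n, ∀ x : I, a • f x = 0 := by
    intro a ha x
    have hx : x ∈ Submodule.span A (s : Set I) := by rw [hs]; trivial
    induction hx using Submodule.span_induction with
    | mem x hx =>
      exact hk _ a (Ideal.pow_le_pow_right (Finset.le_sup (f := fun x => k (f x)) hx) ha)
    | zero => simp
    | add x y _ _ hx hy => rw [map_add, smul_add, hx, hy, add_zero]
    | smul r x _ hx => rw [map_smul, smul_comm, hx, smul_zero]
  obtain ⟨c, hc⟩ := Ideal.exists_pow_inf_eq_pow_smul (maximalIdeal A) (I : Submodule A A)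
  have hc' := hc (n + c) (by omega)
  rw [Nat.add_sub_cancel] at hc'
  set l := n + c
  have hzero : ∀ x : I, (x : A) ∈ maximalIdeal A ^ l → f x = 0 := by
    intro x hx
    have hx2 : (x : A) ∈ maximalIdeal A ^ n • (maximalIdeal A ^ c • (⊤ : Submodule A A) ⊓ I) := by
      rw [← hc']
      exact ⟨by simpa using hx, x.2⟩
    have hle : maximalIdeal A ^ n • (maximalIdeal A ^ c • (⊤ : Submodule A A) ⊓ I) ≤
        (LinearMap.ker f).map I.subtype := by
      rw [Submodule.smul_le]
      intro a ha y hy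
      refine ⟨a • ⟨y, hy.2⟩, ?_, rfl⟩
      change f _ = 0
      rw [map_smul, hkill a ha]
    obtain ⟨y, hy, hyx⟩ := hle hx2
    have : y = x := Subtype.ext hyx
    exact this ▸ hy
  let φ : I →ₗ[A] (A ⧸ maximalIdeal A ^ l) := (maximalIdeal A ^ l).mkQ ∘ₗ I.subtype
  have hφ : LinearMap.ker φ ≤ LinearMap.ker f := by
    intro x hx
    refine hzero x ?_
    have : (maximalIdeal A ^ l).mkQ (x : A) = 0 := hx
    rwa [← LinearMap.mem_ker, Submodule.ker_mkQ] at this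
  let f' : LinearMap.range φ →ₗ[A] E :=
    ((LinearMap.ker φ).liftQ f hφ) ∘ₗ φ.quotKerEquivRange.symm.toLinearMap
  have hf' : ∀ x, f' ⟨φ x, ⟨x, rfl⟩⟩ = f x := by
    intro x
    have : φ.quotKerEquivRange.symm ⟨φ x, ⟨x, rfl⟩⟩ = Submodule.Quotient.mk x := by
      rw [LinearEquiv.symm_apply_eq]
      rfl
    change (LinearMap.ker φ).liftQ f hφ (φ.quotKerEquivRange.symm ⟨φ x, ⟨x, rfl⟩⟩) = _
    rw [this]
    rfl
  have hev : EV A ((A ⧸ maximalIdeal A ^ l) ⧸ LinearMap.range φ) E 1 := by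
    refine ev_of_killed h1 l _ ?_
    intro a ha x
    obtain ⟨x, rfl⟩ := Submodule.mkQ_surjective _ x
    obtain ⟨x, rfl⟩ := Submodule.mkQ_surjective _ x
    rw [← map_smul, ← map_smul]
    have : (maximalIdeal A ^ l).mkQ (a • x) = 0 := by
      rw [← LinearMap.mem_ker, Submodule.ker_mkQ]
      exact Ideal.mul_mem_right _ _ ha
    rw [this, map_zero]
  obtain ⟨g, hg⟩ := ext_lift _ hev f'
  refine ⟨g ∘ₗ (maximalIdeal A ^ l).mkQ, fun x hx => ?_⟩
  have := hg ⟨φ ⟨x, hx⟩, ⟨_, rfl⟩⟩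
  rw [hf'] at this
  exact this

end LocInj
end GGP

set_option linter.unusedSectionVars false

namespace GGP

open CategoryTheory Abelian IsLocalRing
open scoped Pointwise

section Step

variable {R : Type u} [CommRing R]

/-- Localization of the ring at a prime. -/
abbrev RL (p : PrimeSpectrum R) : Type u := Localization.AtPrime p.asIdeal

/-- Localization of a module at a prime. -/
abbrev LM (p : PrimeSpectrum R) (K : Type u) [AddCommGroup K] [Module R K] : Type u :=
  LocalizedModule p.asIdeal.primeCompl K

/-- The localization map. -/
noncomputable abbrev lm (p : PrimeSpectrum R) (K : Type u) [AddCommGroup K] [Module R K] :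
    K →ₗ[R] LM p K := LocalizedModule.mkLinearMap p.asIdeal.primeCompl K

variable {K : Type u} [AddCommGroup K] [Module R K]

theorem lm_eq_zero {p : PrimeSpectrum R} {x : K} :
    lm p K x = 0 ↔ ∃ s : R, s ∉ p.asIdeal ∧ s • x = 0 := by
  rw [IsLocalizedModule.eq_zero_iff p.asIdeal.primeCompl]
  exact ⟨fun ⟨s, hs⟩ => ⟨s, s.2, hs⟩, fun ⟨s, h1, h2⟩ => ⟨⟨s, h1⟩, h2⟩⟩

theorem lm_surj (p : PrimeSpectrum R) (e : LM p K) :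
    ∃ (s : R) (x : K), s ∉ p.asIdeal ∧ s • e = lm p K x := by
  obtain ⟨⟨x, s⟩, h⟩ := IsLocalizedModule.surj p.asIdeal.primeCompl (lm p K) e
  exact ⟨s, x, s.2, h⟩

/-- Elements outside the prime act injectively. -/
theorem lm_cancel {p : PrimeSpectrum R} {s : R} (hs : s ∉ p.asIdeal) {e : LM p K}
    (h : s • e = 0) : e = 0 :=
  IsLocalizedModule.smul_injective (lm p K) (⟨s, hs⟩ : p.asIdeal.primeCompl)
    (by simpa [Submonoid.smul_def] using h)

/-- The height-graded vanishing condition. -/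
def PP (R : Type u) [CommRing R] (j : ℕ) (K : Type u) [AddCommGroup K] [Module R K] : Prop :=
  ∀ (p : PrimeSpectrum R) (i : ℕ), p.asIdeal.height ≠ ((i + j : ℕ) : ℕ∞) →
    EV (RL p) (RL p ⧸ maximalIdeal (RL p)) (LM p K) i

/-- A nonzero map from the residue field. -/
theorem not_ev_zero (p : PrimeSpectrum R) (e : LM p K) (he : e ≠ 0)
    (h : ∀ a ∈ p.asIdeal, a • e = 0) :
    ¬ EV (RL p) (RL p ⧸ maximalIdeal (RL p)) (LM p K) 0 := by
  rw [EV.zero_iff]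
  intro hc
  let g : RL p →ₗ[RL p] LM p K := LinearMap.toSpanSingleton _ _ e
  have hle : maximalIdeal (RL p) ≤ LinearMap.ker g := by
    rw [← Localization.AtPrime.map_eq_maximalIdeal, Ideal.map_le_iff_le_comap]
    intro a ha
    change algebraMap R (RL p) a • e = 0
    rw [algebraMap_smul]
    exact h a ha
  have := LinearMap.congr_fun (hc ((maximalIdeal (RL p)).liftQ g hle)) (Submodule.Quotient.mk 1)
  apply he
  have h2 : g 1 = 0 := this
  simpa [g] using h2

variable [IsNoetherianRing R]

theorem ht_of_ass {j : ℕ} (hK : PP R j K) (q : PrimeSpectrum R) (h : IsAssociatedPrime q.asIdeal K) :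
    q.asIdeal.height = j := by
  rw [isAssociatedPrime_iff] at h
  obtain ⟨-, x, hx⟩ := h
  by_contra hne
  have hmem : ∀ a, a ∈ q.asIdeal ↔ a • x = 0 := by
    intro a
    rw [hx, Submodule.mem_colon_singleton, Submodule.mem_bot]
  refine not_ev_zero q (lm q K x) ?_ ?_ (hK q 0 (by simpa using hne))
  · intro h0
    obtain ⟨s, hs, hsx⟩ := lm_eq_zero.mp h0
    exact hs ((hmem s).mpr hsx)
  · intro a ha
    rw [← map_smul, (hmem a).mp ha, map_zero]

theorem exists_ass {j : ℕ} (hK : PP R j K) (x : K) (hx : x ≠ 0) :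
    ∃ q : PrimeSpectrum R, q.asIdeal.height = j ∧ lm q K x ≠ 0 := by
  obtain ⟨P, hP, hle⟩ := exists_le_isAssociatedPrime_of_isNoetherianRing R x hx
  refine ⟨⟨P, hP.isPrime⟩, ht_of_ass hK _ hP, ?_⟩
  intro h0
  obtain ⟨s, hs, hsx⟩ := lm_eq_zero.mp h0
  exact hs (hle (by rw [Submodule.mem_colon_singleton, Submodule.mem_bot]; exact hsx))

theorem lt_height {p q : PrimeSpectrum R} (h : p < q) : p.asIdeal.height < q.asIdeal.height := by
  have := p.2
  have := q.2
  exact Ideal.height_strict_mono_of_isPrime h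

theorem min_of_ne_zero {j : ℕ} (hK : PP R j K) (x : K) (q : PrimeSpectrum R)
    (hq : q.asIdeal.height = j) (hx : lm q K x ≠ 0) :
    q.asIdeal ∈ (Module.annihilator R (Submodule.span R {x})).minimalPrimes := by
  have hann : ∀ a, a ∈ Module.annihilator R (Submodule.span R {x}) ↔ a • x = 0 := fun a =>
    Submodule.mem_annihilator_span_singleton x a
  have hle : Module.annihilator R (Submodule.span R {x}) ≤ q.asIdeal := by
    intro a ha
    by_contra hn
    exact hx (lm_eq_zero.mpr ⟨a, hn, (hann a).mp ha⟩)
  obtain ⟨P, hP, hPq⟩ := Ideal.exists_minimalPrimes_le hle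
  have hass := Module.associatedPrimes.minimalPrimes_annihilator_subset_associatedPrimes R
    (Submodule.span R {x}) hP
  have hass2 : IsAssociatedPrime P K := IsAssociatedPrime.map_of_injective
    (Submodule.span R {x}).subtype hass Subtype.val_injective
  have hh := ht_of_ass hK ⟨P, hP.1.1⟩ hass2
  rcases hPq.lt_or_eq with hlt | rfl
  · have := lt_height (p := ⟨P, hP.1.1⟩) (q := q) hlt
    rw [hh, hq] at this
    exact absurd this (lt_irrefl _)
  · exact hP

theorem finite_ne {j : ℕ} (hK : PP R j K) (x : K) :
    {q : PrimeSpectrum R | q.asIdeal.height = j ∧ lm q K x ≠ 0}.Finite := by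
  have hfin := Ideal.finite_minimalPrimes_of_isNoetherianRing R
    (Module.annihilator R (Submodule.span R {x}))
  refine Set.Finite.of_finite_image (f := PrimeSpectrum.asIdeal) (hfin.subset ?_) ?_
  · rintro _ ⟨q, ⟨h1, h2⟩, rfl⟩
    exact min_of_ne_zero hK x q h1 h2
  · intro a _ b _ h
    exact PrimeSpectrum.ext h

/-- Torsion property of localizations at height `j`. -/
theorem torsion_aux {j : ℕ} (hK : PP R j K) (q : PrimeSpectrum R) (hq : q.asIdeal.height = j)
    (e : LM q K) : ∃ k, ∀ a ∈ maximalIdeal (RL q) ^ k, a • e = 0 := by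
  by_cases he : e = 0
  · exact ⟨0, fun a _ => by rw [he, smul_zero]⟩
  have hann : ∀ a, a ∈ Module.annihilator (RL q) (Submodule.span (RL q) {e}) ↔ a • e = 0 := fun a =>
    Submodule.mem_annihilator_span_singleton e a
  have hrad : (Module.annihilator (RL q) (Submodule.span (RL q) {e})).radical =
      maximalIdeal (RL q) := by
    rw [← Ideal.sInf_minimalPrimes]
    have hmin : ∀ P ∈ (Module.annihilator (RL q) (Submodule.span (RL q) {e})).minimalPrimes,
        P = maximalIdeal (RL q) := by
      intro P hP
      have hass := Module.associatedPrimes.minimalPrimes_annihilator_subset_associatedPrimes (RL q)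
        (Submodule.span (RL q) {e}) hP
      have hass2 : IsAssociatedPrime P (LM q K) := IsAssociatedPrime.map_of_injective
        (Submodule.span (RL q) {e}).subtype hass Subtype.val_injective
      have hass3 := Module.associatedPrimes.comap_mem_associatedPrimes_of_mem_associatedPrimes_of_isLocalizedModule_of_fg
        q.asIdeal.primeCompl (lm q K) P hass2 (IsNoetherian.noetherian _)
      have hPp := hP.1.1
      have hPle : P.comap (algebraMap R (RL q)) ≤ q.asIdeal := by
        have h1 := Ideal.comap_mono (f := algebraMap R (RL q)) (le_maximalIdeal hPp.ne_top)
        exact h1.trans (Localization.AtPrime.under_maximalIdeal (I := q.asIdeal)).le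
      have hh := ht_of_ass hK ⟨P.comap (algebraMap R (RL q)), hPp.comap _⟩ hass3
      have heq : P.comap (algebraMap R (RL q)) = q.asIdeal := by
        rcases hPle.lt_or_eq with hlt | h
        · have := lt_height (p := ⟨P.comap (algebraMap R (RL q)), hPp.comap _⟩) (q := q) hlt
          rw [hh, hq] at this
          exact absurd this (lt_irrefl _)
        · exact h
      refine le_antisymm (le_maximalIdeal hPp.ne_top) ?_
      rw [← Localization.AtPrime.map_eq_maximalIdeal, Ideal.map_le_iff_le_comap, heq]
    have hne : Module.annihilator (RL q) (Submodule.span (RL q) {e}) ≠ ⊤ := by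
      intro h
      apply he
      have := (hann 1).mp (h ▸ trivial)
      simpa using this
    obtain ⟨P, hP⟩ := Ideal.nonempty_minimalPrimes hne
    apply le_antisymm
    · have := hmin P hP
      exact this ▸ sInf_le hP
    · exact le_sInf fun P hP => (hmin P hP).ge
  obtain ⟨k, hk⟩ := Ideal.exists_radical_pow_le_of_fg
    (Module.annihilator (RL q) (Submodule.span (RL q) {e})) (IsNoetherian.noetherian _)
  rw [hrad] at hk
  exact ⟨k, fun a ha => (hann a).mp (hk ha)⟩

theorem torsion {j : ℕ} (hK : PP R j K) (q : PrimeSpectrum R) (hq : q.asIdeal.height = j)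
    (e : LM q K) (u : R) (hu : u ∈ q.asIdeal) : ∃ k : ℕ, u ^ k • e = 0 := by
  obtain ⟨k, hk⟩ := torsion_aux hK q hq e
  refine ⟨k, ?_⟩
  have := hk (algebraMap R (RL q) u ^ k) (Ideal.pow_mem_pow (by
    rw [← Localization.AtPrime.map_eq_maximalIdeal]
    exact Ideal.mem_map_of_mem _ hu) k)
  rwa [← map_pow, algebraMap_smul] at this

theorem injective_RL {j : ℕ} (hK : PP R j K) (q : PrimeSpectrum R) (hq : q.asIdeal.height = j) :
    Module.Injective (RL q) (LM q K) :=
  inj_of_torsion (torsion_aux hK q hq) (hK q 1 (by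
    rw [hq]
    intro h
    have : j = 1 + j := by exact_mod_cast h
    omega))

/-- Restriction of scalars preserves injectives (for localizations). -/
theorem injective_restrict (q : PrimeSpectrum R) (h : Module.Injective (RL q) (LM q K)) :
    Module.Injective R (LM q K) := by
  constructor
  intro X Y _ _ _ _ f hf g
  let g' : LM q X →ₗ[R] LM q K := IsLocalizedModule.lift q.asIdeal.primeCompl (lm q X) g
    (fun x => IsLocalizedModule.map_units (lm q K) x)
  let g'' : LM q X →ₗ[RL q] LM q K :=
    g'.extendScalarsOfIsLocalization q.asIdeal.primeCompl (RL q)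
  obtain ⟨H, hH⟩ := h.out (LocalizedModule.map q.asIdeal.primeCompl f)
    (LocalizedModule.map_injective _ f hf) g''
  refine ⟨(H.restrictScalars R) ∘ₗ lm q Y, fun x => ?_⟩
  have h1 := hH (lm q X x)
  have h2 : LocalizedModule.map q.asIdeal.primeCompl f (lm q X x) = lm q Y (f x) := by
    simp [lm, LocalizedModule.mkLinearMap_apply]
  rw [h2] at h1
  refine h1.trans ?_
  exact IsLocalizedModule.lift_apply q.asIdeal.primeCompl (lm q X) g
    (fun x => IsLocalizedModule.map_units (lm q K) x) x

end Step
end GGP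

set_option linter.unusedSectionVars false

namespace GGP

open CategoryTheory Abelian IsLocalRing GG
open scoped Pointwise

section Next

variable {R : Type u} [CommRing R] {K : Type u} [AddCommGroup K] [Module R K]
  {S : Set (PrimeSpectrum R)}

theorem theta_apply (x : K) (q : S) : thetaFull R S K x q = lm q.1 K x := rfl

theorem finSupp_finite (c : finSupp R S K) : {q : S | c.1 q ≠ 0}.Finite := c.2

/-- The direct sum of injectives is injective. -/
theorem finSupp_injective [IsNoetherianRing R] (h : ∀ q ∈ S, Module.Injective R (LM q K)) :
    Module.Injective R (finSupp R S K) := by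
  classical
  apply Module.Baer.injective
  intro I g
  obtain ⟨s, hs⟩ := (inferInstance : Module.Finite R I)
  let T : Set S := ⋃ x ∈ s, {q : S | (g x).1 q ≠ 0}
  have hT : T.Finite := Set.Finite.biUnion s.finite_toSet fun x _ => finSupp_finite (g x)
  let G : ∀ q : S, I →ₗ[R] LM q.1 K := fun q => LinearMap.proj q ∘ₗ (finSupp R S K).subtype ∘ₗ g
  have hG : ∀ q, q ∉ T → G q = 0 := by
    intro q hq
    refine LinearMap.ext_on hs ?_
    intro x hx
    by_contra hne
    exact hq (Set.mem_biUnion hx hne)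
  have hext : ∀ q : S, ∃ g' : R →ₗ[R] LM q.1 K, ∀ (x) (mem : x ∈ I), g' x = G q ⟨x, mem⟩ :=
    fun q => Module.Baer.of_injective (h q.1 q.2) I (G q)
  choose H hH using hext
  let e : locProd R S K := fun q => if q ∈ T then H q 1 else 0
  have he : e ∈ finSupp R S K := by
    refine hT.subset ?_
    intro q hq
    by_contra hn
    exact hq (by simp [e, hn])
  refine ⟨LinearMap.toSpanSingleton R _ ⟨e, he⟩, fun x mem => ?_⟩
  apply Subtype.ext
  funext q
  change x • e q = G q ⟨x, mem⟩
  by_cases hq : q ∈ T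
  · simp only [e, hq, if_true]
    rw [← hH q x mem, ← map_smul, smul_eq_mul, mul_one]
  · simp only [e, hq, if_false, smul_zero]
    rw [hG q hq]
    rfl

variable [IsNoetherianRing R] {j : ℕ}

theorem theta_mem (hK : PP R j K) (hS : ∀ p, p ∈ S → p.asIdeal.height = j) :
    LinearMap.range (thetaFull R S K) ≤ finSupp R S K := by
  rintro _ ⟨x, rfl⟩
  have hf := finite_ne hK x
  refine Set.Finite.of_finite_image (f := Subtype.val) (hf.subset ?_) Subtype.val_injective.injOn
  rintro _ ⟨q, hq, rfl⟩
  exact ⟨hS q.1 q.2, hq⟩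

theorem theta_inj (hK : PP R j K) (hS : ∀ p, p ∈ S ↔ p.asIdeal.height = j) :
    Function.Injective (thetaFull R S K) := by
  rw [injective_iff_map_eq_zero]
  intro x hx
  by_contra hne
  obtain ⟨q, hq, hqx⟩ := exists_ass hK x hne
  exact hqx (congrFun hx ⟨q, (hS q).mpr hq⟩)

theorem finSupp_kill (hK : PP R j K) (hS : ∀ p, p ∈ S → p.asIdeal.height = j)
    (c : finSupp R S K) (p : PrimeSpectrum R) (hc : ∀ q : S, q.1 ≤ p → c.1 q = 0) :
    ∃ s, s ∉ p.asIdeal ∧ s • c = 0 := by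
  classical
  have h1 : ∀ q : S, ∃ s, s ∉ p.asIdeal ∧ s • c.1 q = 0 := by
    intro q
    by_cases hq : q.1 ≤ p
    · exact ⟨1, p.2.one_notMem, by rw [hc q hq, smul_zero]⟩
    · obtain ⟨u, hu, hup⟩ := SetLike.not_le_iff_exists.mp
        (show ¬ q.1.asIdeal ≤ p.asIdeal from hq)
      obtain ⟨k, hk⟩ := torsion hK q.1 (hS q.1 q.2) (c.1 q) u hu
      exact ⟨u ^ k, fun h => hup (p.2.mem_of_pow_mem _ h), hk⟩
  choose s hs hsc using h1
  refine ⟨∏ q ∈ (finSupp_finite c).toFinset, s q, ?_, ?_⟩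
  · exact Submonoid.prod_mem p.asIdeal.primeCompl fun q _ => hs q
  · apply Subtype.ext
    funext q
    change (∏ q ∈ (finSupp_finite c).toFinset, s q) • c.1 q = 0
    by_cases hq : c.1 q = 0
    · rw [hq, smul_zero]
    · obtain ⟨t, ht⟩ := Finset.dvd_prod_of_mem s ((finSupp_finite c).mem_toFinset.mpr hq)
      rw [ht, mul_comm, mul_smul, hsc, smul_zero]

/-- The short exact sequence `K → C → K'`. -/
theorem next_ses (h1 : LinearMap.range (thetaFull R S K) ≤ finSupp R S K)
    (h2 : Function.Injective (thetaFull R S K)) :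
    SES ((thetaFull R S K).codRestrict (finSupp R S K) fun x => h1 ⟨x, rfl⟩)
      (Submodule.mkQ (Submodule.comap (finSupp R S K).subtype
        (LinearMap.range (thetaFull R S K)))) where
  inj := fun x y h => h2 (congrArg Subtype.val h)
  surj := Submodule.mkQ_surjective _
  zero := fun x => (Submodule.Quotient.mk_eq_zero _).mpr ⟨x, rfl⟩
  exact := fun y hy => by
    obtain ⟨x, hx⟩ := (Submodule.Quotient.mk_eq_zero _).mp hy
    exact ⟨x, Subtype.ext hx⟩

theorem lm_map {L : Type u} [AddCommGroup L] [Module R L] (p : PrimeSpectrum R) (f : K →ₗ[R] L)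
    (x : K) : LocalizedModule.map p.asIdeal.primeCompl f (lm p K x) = lm p L (f x) := by
  simp [lm, LocalizedModule.mkLinearMap_apply]

theorem SES.localize {C K' : Type u} [AddCommGroup C] [Module R C] [AddCommGroup K']
    [Module R K'] {i : K →ₗ[R] C} {f : C →ₗ[R] K'} (h : SES i f) (p : PrimeSpectrum R) :
    SES (LocalizedModule.map p.asIdeal.primeCompl i) (LocalizedModule.map p.asIdeal.primeCompl f) := by
  have hex : Function.Exact i f := fun y => ⟨h.exact y, by rintro ⟨x, rfl⟩; exact h.zero x⟩
  have := LocalizedModule.map_exact p.asIdeal.primeCompl i f hex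
  exact ⟨LocalizedModule.map_injective _ _ h.inj, LocalizedModule.map_surjective _ _ h.surj,
    fun x => (this _).mpr ⟨x, rfl⟩, fun y hy => (this y).mp hy⟩

theorem ev_zero_of (p : PrimeSpectrum R)
    (h : ∀ e : LM p K, (∀ a ∈ p.asIdeal, a • e = 0) → e = 0) :
    EV (RL p) (RL p ⧸ maximalIdeal (RL p)) (LM p K) 0 := by
  rw [EV.zero_iff]
  intro f
  have h0 : f (Submodule.Quotient.mk 1) = 0 := by
    apply h
    intro a ha
    rw [← algebraMap_smul (RL p), ← map_smul, ← Submodule.Quotient.mk_smul, smul_eq_mul, mul_one]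
    have : (Submodule.Quotient.mk (algebraMap R (RL p) a) : RL p ⧸ maximalIdeal (RL p)) = 0 := by
      rw [Submodule.Quotient.mk_eq_zero, ← Localization.AtPrime.map_eq_maximalIdeal]
      exact Ideal.mem_map_of_mem _ ha
    rw [this, map_zero]
  ext
  change f (Submodule.Quotient.mk 1) = 0
  exact h0

theorem ev_finSupp_zero (hK : PP R j K) (hS : ∀ p, p ∈ S → p.asIdeal.height = j)
    (p : PrimeSpectrum R) (hp : p.asIdeal.height ≠ j) :
    EV (RL p) (RL p ⧸ maximalIdeal (RL p)) (LM p (finSupp R S K)) 0 := by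
  classical
  apply ev_zero_of
  intro e he
  obtain ⟨s, c, hs, hsc⟩ := lm_surj p e
  have h1 : ∀ a ∈ p.asIdeal, ∃ t, t ∉ p.asIdeal ∧ t • a • c = 0 := by
    intro a ha
    refine lm_eq_zero.mp (?_ : lm p (finSupp R S K) (a • c) = 0)
    rw [map_smul, ← hsc, smul_comm, he a ha, smul_zero]
  obtain ⟨G, hG⟩ := IsNoetherian.noetherian p.asIdeal
  have h2 : ∀ a : R, ∃ t, t ∉ p.asIdeal ∧ (a ∈ p.asIdeal → t • a • c = 0) := by
    intro a
    by_cases ha : a ∈ p.asIdeal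
    · obtain ⟨t, h, h'⟩ := h1 a ha
      exact ⟨t, h, fun _ => h'⟩
    · exact ⟨1, p.2.one_notMem, fun h => absurd h ha⟩
  choose t ht htc using h2
  let T := ∏ a ∈ G, t a
  have hT : T ∉ p.asIdeal := Submonoid.prod_mem p.asIdeal.primeCompl fun q _ => ht q
  have hTa : ∀ a ∈ p.asIdeal, T • a • c = 0 := by
    have : p.asIdeal ≤ LinearMap.ker (LinearMap.toSpanSingleton R (finSupp R S K) (T • c)) := by
      conv_lhs => rw [← hG]
      rw [Submodule.span_le]
      intro a ha
      change a • T • c = 0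
      have hap : a ∈ p.asIdeal := hG ▸ Submodule.subset_span ha
      obtain ⟨w, hw⟩ := Finset.dvd_prod_of_mem t ha
      rw [smul_comm]
      change (∏ a ∈ G, t a) • a • c = 0
      rw [hw, mul_comm, mul_smul, htc a hap, smul_zero]
    intro a ha
    have h3 : a • T • c = 0 := this ha
    rwa [smul_comm] at h3
  obtain ⟨s', hs', hs'c⟩ := finSupp_kill hK hS c p (by
    intro q hq
    have hne : ¬ p.asIdeal ≤ q.1.asIdeal := by
      intro h
      apply hp
      have : p = q.1 := le_antisymm h hq
      rw [this]
      exact hS _ q.2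
    obtain ⟨a, ha, haq⟩ := SetLike.not_le_iff_exists.mp hne
    have h4 : T • a • c.1 q = 0 := congrFun (congrArg Subtype.val (hTa a ha)) q
    exact lm_cancel haq (lm_cancel (fun h => hT (hq h)) h4))
  refine lm_cancel hs ?_
  rw [hsc]
  exact lm_eq_zero.mpr ⟨s', hs', hs'c⟩

theorem PP_next (hK : PP R j K) (hS : ∀ p, p ∈ S ↔ p.asIdeal.height = j) :
    PP R (j + 1) (nextKType R S K) := by
  have hS' : ∀ p, p ∈ S → p.asIdeal.height = j := fun p h => (hS p).mp h
  intro p i hne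
  by_cases hp : p.asIdeal.height = j
  · have : Subsingleton (LM p (nextKType R S K)) := by
      refine subsingleton_of_forall_eq 0 fun e => ?_
      obtain ⟨s, k, hs, hsk⟩ := lm_surj p e
      refine lm_cancel hs ?_
      rw [hsk]
      obtain ⟨c, rfl⟩ := Submodule.mkQ_surjective _ k
      obtain ⟨s1, x, hs1, hx⟩ := lm_surj p (c.1 ⟨p, (hS p).mpr hp⟩)
      let θ := (thetaFull R S K).codRestrict (finSupp R S K) fun x => theta_mem hK hS' ⟨x, rfl⟩
      obtain ⟨s2, hs2, h2⟩ := finSupp_kill hK hS' (s1 • c - θ x) p (by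
        intro q hq
        have hqp : q = ⟨p, (hS p).mpr hp⟩ := by
          apply Subtype.ext
          rcases hq.lt_or_eq with hlt | h
          · have := lt_height hlt
            rw [hp, hS' _ q.2] at this
            exact absurd this (lt_irrefl _)
          · exact h
        subst hqp
        change s1 • c.1 ⟨p, (hS p).mpr hp⟩ - lm p K x = 0
        rw [hx, sub_self])
      refine lm_eq_zero.mpr ⟨s2 * s1, fun h => (p.2.mem_or_mem h).elim hs2 hs1, ?_⟩
      rw [← map_smul]
      refine (Submodule.Quotient.mk_eq_zero _).mpr ⟨s2 • x, ?_⟩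
      rw [smul_sub, sub_eq_zero, smul_smul] at h2
      rw [h2, map_smul]
      rfl
    exact EV.of_subsingleton i
  · refine ((next_ses (theta_mem hK hS') (theta_inj hK hS)).localize p).ev_cov_right ?_
      (hK p (i + 1) (by intro h; apply hne; rw [h]; congr 1; omega))
    cases i with
    | zero => exact ev_finSupp_zero hK hS' p hp
    | succ i =>
      have := finSupp_injective (R := R) (S := S) (K := K)
        fun q hq => injective_restrict q (injective_RL hK q (hS' q hq))
      exact EV.of_injective (Module.injective_of_isLocalizedModule p.asIdeal.primeCompl
        (lm p (finSupp R S K))) i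

theorem PP_zero {n : ℕ} (hid : idLE R R n) : PP R 0 R := by
  intro p i hne
  have h1 := ev_of_idLE n hid
  have h2 := ModuleCat.localizedModule_hasInjectiveDimensionLE n p.asIdeal.primeCompl
    (ModuleCat.of R R)
  have := ModuleCat.localizedModule_isLocalizedModule (ModuleCat.of R R) p.asIdeal.primeCompl
  let e0 := IsLocalizedModule.linearEquiv p.asIdeal.primeCompl
    ((ModuleCat.of R R).localizedModuleMkLinearMap p.asIdeal.primeCompl)
    (Algebra.linearMap R (RL p))
  let e1 := e0.extendScalarsOfIsLocalization p.asIdeal.primeCompl (RL p)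
  let f0 := IsLocalizedModule.linearEquiv p.asIdeal.primeCompl
    (Algebra.linearMap R (RL p)) (lm p R)
  let f1 := f0.extendScalarsOfIsLocalization p.asIdeal.primeCompl (RL p)
  have h3 : HasInjectiveDimensionLE (ModuleCat.of (RL p) (RL p)) n :=
    hasInjectiveDimensionLT_of_iso e1.toModuleIso (n + 1)
  refine EV.congr (LinearEquiv.refl _ _) f1 (local_ext h3 i ?_)
  rw [IsLocalization.AtPrime.ringKrullDim_eq_height p.asIdeal (RL p)]
  intro h
  apply hne
  have : ((i : ℕ∞) : WithBot ℕ∞) = (p.asIdeal.height : WithBot ℕ∞) := h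
  exact (WithBot.coe_injective this).symm

end Next
end GGP

set_option linter.unusedSectionVars false

namespace GGP

open CategoryTheory Abelian IsLocalRing GG Matrix

section ZStep

variable {R : Type u} [CommRing R] {K L : Type u} [AddCommGroup K] [Module R K]
  [AddCommGroup L] [Module R L] {S : Set (PrimeSpectrum R)} {a b c : ℕ}

/-- `j` identifies `K` with the kernel of the matrix `A` on tuples. -/
structure IsZ (A : Matrix (Fin b) (Fin a) R) (j : Fin a → (K →ₗ[R] L)) : Prop where
  inj : ∀ x, (∀ i, j i x = 0) → x = 0
  zero : ∀ x, act A L (fun i => j i x) = 0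
  exact : ∀ z, act A L z = 0 → ∃ x, ∀ i, j i x = z i

/-- Common element outside a prime. -/
theorem common (p : PrimeSpectrum R) {n : ℕ} (P : Fin n → R → Prop)
    (hmul : ∀ i s t, P i s → P i (t * s)) (h : ∀ i, ∃ s, s ∉ p.asIdeal ∧ P i s) :
    ∃ s, s ∉ p.asIdeal ∧ ∀ i, P i s := by
  classical
  choose s hs hP using h
  refine ⟨∏ i, s i, Submonoid.prod_mem p.asIdeal.primeCompl fun q _ => hs q, fun i => ?_⟩
  obtain ⟨t, ht⟩ := Finset.dvd_prod_of_mem s (Finset.mem_univ i)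
  rw [ht, mul_comm]
  exact hmul i _ _ (hP i)

/-- The localized map as an `R`-linear map. -/
noncomputable def lmap (p : PrimeSpectrum R) (f : K →ₗ[R] L) : LM p K →ₗ[R] LM p L :=
  (LocalizedModule.map p.asIdeal.primeCompl f).restrictScalars R

theorem lmap_lm (p : PrimeSpectrum R) (f : K →ₗ[R] L) (x : K) :
    lmap p f (lm p K x) = lm p L (f x) := by
  simp [lmap, lm, LocalizedModule.mkLinearMap_apply]

theorem lm_div (p : PrimeSpectrum R) (x : K) (s : R) (hs : s ∉ p.asIdeal) :
    ∃ e : LM p K, s • e = lm p K x := by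
  obtain ⟨e, he⟩ := ((IsLocalizedModule.map_units (lm p K) (⟨s, hs⟩ : p.asIdeal.primeCompl)) |>
    (Module.End.isUnit_iff _).mp).2 (lm p K x)
  exact ⟨e, he⟩

theorem IsZ.localize {A : Matrix (Fin b) (Fin a) R} {j : Fin a → (K →ₗ[R] L)} (h : IsZ A j)
    (p : PrimeSpectrum R) : IsZ A (fun i => lmap p (j i)) where
  inj := by
    intro e he
    obtain ⟨s, x, hs, hx⟩ := lm_surj p e
    refine lm_cancel hs ?_
    rw [hx]
    obtain ⟨t, ht, htx⟩ := common p (fun i t => t • j i x = 0)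
      (fun i s t hst => by rw [mul_smul, hst, smul_zero]) (fun i => by
        refine lm_eq_zero.mp (?_ : lm p L (j i x) = 0)
        rw [← lmap_lm, ← hx, map_smul, he i, smul_zero])
    refine lm_eq_zero.mpr ⟨t, ht, h.inj _ fun i => ?_⟩
    rw [map_smul, htx i]
  zero := by
    intro e
    obtain ⟨s, x, hs, hx⟩ := lm_surj p e
    funext k
    refine lm_cancel hs ?_
    have h1 : s • act A (LM p L) (fun i => lmap p (j i) e) =
        act A (LM p L) (fun i => lm p L (j i x)) := by
      rw [← map_smul]
      congr 1
      funext i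
      rw [← lmap_lm, ← hx, map_smul]
      rfl
    have h2 := congrFun h1 k
    rw [act_map, h.zero x] at h2
    refine h2.trans ?_
    simp
  exact := by
    intro z hz
    obtain ⟨s, hs, hsz⟩ := common p (fun i t => ∃ w, t • z i = lm p L w)
      (fun i s t ⟨w, hw⟩ => ⟨t • w, by rw [mul_smul, hw, map_smul]⟩) (fun i => by
        obtain ⟨s, w, hs, hw⟩ := lm_surj p (z i)
        exact ⟨s, hs, w, hw⟩)
    choose w hw using hsz
    have h1 : ∀ k, lm p L (act A L w k) = 0 := by
      intro k
      have : act A (LM p L) (s • z) = 0 := by rw [map_smul, hz, smul_zero]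
      have h2 : s • z = fun i => lm p L (w i) := funext hw
      rw [h2, act_map] at this
      exact congrFun this k
    obtain ⟨t, ht, htw⟩ := common p (fun k t => t • act A L w k = 0)
      (fun i s t hst => by rw [mul_smul, hst, smul_zero]) (fun k => lm_eq_zero.mp (h1 k))
    obtain ⟨x, hx⟩ := h.exact (t • w) (by
      rw [map_smul]
      exact funext htw)
    have hts : t * s ∉ p.asIdeal := fun h => (p.2.mem_or_mem h).elim ht hs
    obtain ⟨e, he⟩ := lm_div p x (t * s) hts
    refine ⟨e, fun i => sub_eq_zero.mp (lm_cancel hts ?_)⟩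
    rw [smul_sub, ← map_smul, he, lmap_lm, hx i, mul_smul, hw i]
    simp

/-- The induced map on direct sums of localizations. -/
noncomputable def fsMap (S : Set (PrimeSpectrum R)) (f : K →ₗ[R] L) :
    finSupp R S K →ₗ[R] finSupp R S L :=
  LinearMap.codRestrict _ (LinearMap.pi (fun q : S => lmap q.1 f ∘ₗ LinearMap.proj q) ∘ₗ
    (finSupp R S K).subtype) (by
      intro x
      refine (finSupp_finite x).subset ?_
      intro q hq h0
      apply hq
      change lmap q.1 f (x.1 q) = 0
      rw [h0, map_zero])

theorem fsMap_apply (f : K →ₗ[R] L) (x : finSupp R S K) (q : S) :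
    (fsMap S f x).1 q = lmap q.1 f (x.1 q) := rfl

theorem act_fs {A : Matrix (Fin b) (Fin a) R} (z : Fin a → finSupp R S L) (q : S) (k : Fin b) :
    (act A (finSupp R S L) z k).1 q = act A (LM q.1 L) (fun i => (z i).1 q) k := by
  have := congrFun (act_map A (LinearMap.proj q ∘ₗ (finSupp R S L).subtype) z) k
  exact this.symm

theorem IsZ.fs {A : Matrix (Fin b) (Fin a) R} {j : Fin a → (K →ₗ[R] L)} (h : IsZ A j) :
    IsZ A (fun i => fsMap S (j i)) where
  inj := by
    intro x hx
    apply Subtype.ext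
    funext q
    refine (h.localize q.1).inj _ fun i => ?_
    exact congrFun (congrArg Subtype.val (hx i)) q
  zero := by
    intro x
    funext k
    apply Subtype.ext
    funext q
    rw [act_fs]
    exact congrFun ((h.localize q.1).zero (x.1 q)) k
  exact := by
    intro z hz
    have h1 : ∀ q : S, ∃ e : LM q.1 K, ∀ i, lmap q.1 (j i) e = (z i).1 q := by
      intro q
      refine (h.localize q.1).exact _ ?_
      funext k
      have := act_fs (A := A) z q k
      rw [hz] at this
      exact this.symm
    choose e he using h1
    have hmem : e ∈ finSupp R S K := by
      refine (Set.finite_iUnion fun i => finSupp_finite (z i)).subset ?_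
      intro q hq
      by_contra hn
      apply hq
      refine (h.localize q.1).inj _ fun i => ?_
      rw [he q i]
      by_contra h2
      exact hn (Set.mem_iUnion.mpr ⟨i, h2⟩)
    refine ⟨⟨e, hmem⟩, fun i => ?_⟩
    apply Subtype.ext
    funext q
    exact he q i

theorem IsZ.theta_mem {A : Matrix (Fin b) (Fin a) R} {j : Fin a → (K →ₗ[R] L)} (h : IsZ A j)
    (hL : LinearMap.range (thetaFull R S L) ≤ finSupp R S L) :
    LinearMap.range (thetaFull R S K) ≤ finSupp R S K := by
  rintro _ ⟨x, rfl⟩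
  refine (Set.finite_iUnion fun i => (hL ⟨j i x, rfl⟩ :
    {q : S | thetaFull R S L (j i x) q ≠ 0}.Finite)).subset ?_
  intro q hq
  by_contra hn
  apply hq
  refine (h.localize q.1).inj _ fun i => ?_
  rw [theta_apply, lmap_lm]
  by_contra h2
  exact hn (Set.mem_iUnion.mpr ⟨i, h2⟩)

theorem IsZ.theta_inj {A : Matrix (Fin b) (Fin a) R} {j : Fin a → (K →ₗ[R] L)} (h : IsZ A j)
    (hL : Function.Injective (thetaFull R S L)) : Function.Injective (thetaFull R S K) := by
  rw [injective_iff_map_eq_zero] at hL ⊢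
  intro x hx
  refine h.inj x fun i => hL _ ?_
  funext q
  rw [theta_apply, ← lmap_lm, ← theta_apply (S := S), hx]
  exact map_zero _

/-- The induced map on cokernels. -/
noncomputable def nextMap (S : Set (PrimeSpectrum R)) (f : K →ₗ[R] L) :
    nextKType R S K →ₗ[R] nextKType R S L :=
  Submodule.mapQ _ _ (fsMap S f) (by
    rintro c ⟨x, hx⟩
    refine ⟨f x, ?_⟩
    funext q
    rw [theta_apply, ← lmap_lm]
    change _ = lmap q.1 f (c.1 q)
    congr 1
    exact congrFun hx q)

theorem IsZ.next {A : Matrix (Fin b) (Fin a) R} {j : Fin a → (K →ₗ[R] L)} (h : IsZ A j)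
    (hL : LinearMap.range (thetaFull R S L) ≤ finSupp R S L)
    (hLi : Function.Injective (thetaFull R S L))
    (B : Matrix (Fin a) (Fin c) R) (hAB : A * B = 0) (hex : EX B A (nextKType R S L)) :
    IsZ A (fun i => nextMap S (j i)) where
  inj := by
    intro k hk
    obtain ⟨x, rfl⟩ := Submodule.mkQ_surjective _ k
    have h1 : ∀ i, ∃ y, thetaFull R S L y = (fsMap S (j i) x).1 := fun i =>
      (Submodule.Quotient.mk_eq_zero _).mp (hk i)
    choose y hy using h1
    have h2 : act A L y = 0 := by
      funext k
      apply hLi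
      rw [← congrFun (act_map A (thetaFull R S L) y) k]
      have h3 := congrFun (act_map A (finSupp R S L).subtype (fun i => fsMap S (j i) x)) k
      rw [h.fs.zero x] at h3
      have h4 : (fun i => thetaFull R S L (y i)) =
        fun i => (finSupp R S L).subtype (fsMap S (j i) x) := funext hy
      rw [h4, h3]
      simp
    obtain ⟨w, hw⟩ := h.exact y h2
    refine (Submodule.Quotient.mk_eq_zero _).mpr ⟨w, ?_⟩
    funext q
    refine sub_eq_zero.mp ((h.localize q.1).inj _ fun i => ?_)
    rw [map_sub, theta_apply, lmap_lm, hw i, sub_eq_zero]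
    exact congrFun (hy i) q
  zero := by
    intro k
    obtain ⟨x, rfl⟩ := Submodule.mkQ_surjective _ k
    have := act_map A (Submodule.mkQ (Submodule.comap (finSupp R S L).subtype
      (LinearMap.range (thetaFull R S L)))) (fun i => fsMap S (j i) x)
    rw [h.fs.zero x] at this
    refine Eq.trans this ?_
    funext k
    exact map_zero _
  exact := by
    intro z hz
    obtain ⟨u, rfl⟩ := hex z hz
    have h1 : ∀ i, ∃ v, Submodule.mkQ (Submodule.comap (finSupp R S L).subtype
      (LinearMap.range (thetaFull R S L))) v = u i := fun i => Submodule.mkQ_surjective _ (u i)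
    choose v hv using h1
    obtain ⟨x, hx⟩ := h.fs.exact (act B _ v) (by rw [act_act, hAB, act_zero])
    refine ⟨Submodule.mkQ _ x, fun i => ?_⟩
    have h2 := congrFun (act_map B (Submodule.mkQ (Submodule.comap (finSupp R S L).subtype
      (LinearMap.range (thetaFull R S L)))) v) i
    rw [show (fun j => Submodule.mkQ (Submodule.comap (finSupp R S L).subtype
      (LinearMap.range (thetaFull R S L))) (v j)) = u from funext hv, ← hx i] at h2
    exact h2.symm

end ZStep
end GGP

set_option linter.unusedSectionVars false

namespace GGP

open CategoryTheory Abelian IsLocalRing GG Matrix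

section Height

variable {R : Type u} [CommRing R]

theorem hf_mem {M : Type u} [AddCommGroup M] [Module R M] (hM : ∀ p, p ∈ Module.support R M)
    (n : ℕ) (p : PrimeSpectrum R) :
    p ∈ heightFiltration R M n \ heightFiltration R M (n + 1) ↔ p.asIdeal.height = n := by
  have h1 : ∀ p, htM R M p = p.asIdeal.height := by
    intro p
    unfold htM
    rw [iSup_pos (hM p)]
    let e : ↥(Module.support R M) ≃o PrimeSpectrum R :=
      { toFun := fun x => x.1, invFun := fun x => ⟨x, hM x⟩, left_inv := fun _ => rfl,
        right_inv := fun _ => rfl, map_rel_iff' := Iff.rfl }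
    rw [← Order.height_orderIso e]
    exact (PrimeSpectrum.height_eq_orderHeight _).symm
  have h2 : ∀ k : ℕ, p ∈ heightFiltration R M k ↔ (k : ℕ∞) ≤ p.asIdeal.height := by
    intro k
    rw [← h1 p]
    exact ⟨fun h => h.2, fun h => ⟨hM p, h⟩⟩
  rw [Set.mem_sdiff, h2, h2, not_le]
  constructor
  · rintro ⟨ha, hb⟩
    refine le_antisymm ?_ ha
    push_cast at hb
    exact Order.le_of_lt_add_one hb
  · intro h
    rw [h]
    exact ⟨le_rfl, by exact_mod_cast Nat.lt_succ_self n⟩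

theorem supp_of {M : Type u} [AddCommGroup M] [Module R M] (x : M)
    (hx : ∀ a : R, a • x = 0 → a = 0) (p : PrimeSpectrum R) : p ∈ Module.support R M := by
  rw [Module.mem_support_iff_exists_annihilator]
  refine ⟨x, fun a ha => ?_⟩
  rw [hx a ((Submodule.mem_annihilator_span_singleton x a).mp ha)]
  exact zero_mem _

end Height

section Main

variable {R : Type u} [CommRing R] [IsNoetherianRing R] {F : ℕ → Set (PrimeSpectrum R)}

theorem PP_all {N : ℕ} (hid : idLE R R N) (hF : ∀ n p, p ∈ F n \ F (n + 1) ↔ p.asIdeal.height = n)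
    (n : ℕ) : PP R n (cousinK R F (ModuleCat.of R R) n) := by
  induction n with
  | zero => exact PP_zero hid
  | succ n ih => exact PP_next ih (hF n)

theorem C_inj {N : ℕ} (hid : idLE R R N) (hF : ∀ n p, p ∈ F n \ F (n + 1) ↔ p.asIdeal.height = n)
    (n : ℕ) : Module.Injective R (cousinC R F (ModuleCat.of R R) n) :=
  finSupp_injective fun q hq => injective_restrict q
    (injective_RL (PP_all hid hF n) q ((hF n q).mp hq))

theorem th_mem {N : ℕ} (hid : idLE R R N) (hF : ∀ n p, p ∈ F n \ F (n + 1) ↔ p.asIdeal.height = n)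
    (n : ℕ) : LinearMap.range (thetaFull R (F n \ F (n + 1)) (cousinK R F (ModuleCat.of R R) n)) ≤
      finSupp R (F n \ F (n + 1)) (cousinK R F (ModuleCat.of R R) n) :=
  theta_mem (PP_all hid hF n) fun p h => (hF n p).mp h

theorem th_inj {N : ℕ} (hid : idLE R R N) (hF : ∀ n p, p ∈ F n \ F (n + 1) ↔ p.asIdeal.height = n)
    (n : ℕ) : Function.Injective
      (thetaFull R (F n \ F (n + 1)) (cousinK R F (ModuleCat.of R R) n)) :=
  theta_inj (PP_all hid hF n) (hF n)

variable {r : ℤ → ℕ} {D : ∀ n : ℤ, Matrix (Fin (r (n + 1))) (Fin (r n)) R}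

theorem EX_inj (h2 : ∀ n, EX (D (n + 1))ᵀ (D n)ᵀ R) {C : Type u} [AddCommGroup C] [Module R C]
    (hC : Module.Injective R C) (m : ℤ) : EX (D m) (D (m + 1)) C :=
  EX_of_injective hC (h2 m)

theorem EX_inj' (h1 : ∀ n, EX (D n) (D (n + 1)) R) {C : Type u} [AddCommGroup C] [Module R C]
    (hC : Module.Injective R C) (m : ℤ) : EX (D (m + 1))ᵀ (D m)ᵀ C :=
  EX_of_injective hC (by rw [transpose_transpose, transpose_transpose]; exact h1 m)

theorem EX_all {N : ℕ} (hid : idLE R R N) (hF : ∀ n p, p ∈ F n \ F (n + 1) ↔ p.asIdeal.height = n)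
    (h0 : ∀ n, D (n + 1) * D n = 0) (h1 : ∀ n, EX (D n) (D (n + 1)) R)
    (h2 : ∀ n, EX (D (n + 1))ᵀ (D n)ᵀ R) (n : ℕ) :
    ∀ m, EX (D m) (D (m + 1)) (cousinK R F (ModuleCat.of R R) n) := by
  induction n with
  | zero => exact h1
  | succ n ih =>
    intro m
    exact (next_ses (th_mem hid hF n) (th_inj hid hF n)).ascend (h0 (m + 1))
      (EX_inj h2 (C_inj hid hF n) m) (ih (m + 1))

theorem Z_all {N : ℕ} (hid : idLE R R N) (hF : ∀ n p, p ∈ F n \ F (n + 1) ↔ p.asIdeal.height = n)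
    (h0 : ∀ n, D (n + 1) * D n = 0) (h1 : ∀ n, EX (D n) (D (n + 1)) R)
    (h2 : ∀ n, EX (D (n + 1))ᵀ (D n)ᵀ R) (m : ℤ) (n : ℕ) :
    ∃ j : Fin (r m) → (cousinK R F (ModuleCat.of R (LinearMap.ker (act (D m) R))) n →ₗ[R]
      cousinK R F (ModuleCat.of R R) n), IsZ (D m) j := by
  induction n with
  | zero =>
    refine ⟨fun i => LinearMap.proj i ∘ₗ (LinearMap.ker (act (D m) R)).subtype, ?_, ?_, ?_⟩
    · intro x hx
      exact Subtype.ext (funext hx)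
    · intro x
      exact x.2
    · intro z hz
      exact ⟨⟨z, hz⟩, fun i => rfl⟩
  | succ n ih =>
    obtain ⟨j, hj⟩ := ih
    obtain ⟨k, rfl⟩ : ∃ k, m = k + 1 := ⟨m - 1, by ring⟩
    exact ⟨_, hj.next (th_mem hid hF n) (th_inj hid hF n) (D k) (h0 k)
      (EX_all hid hF h0 h1 h2 (n + 1) k)⟩

/-- Kernels of the totally acyclic matrices on injectives are Gorenstein injective. -/
theorem gorInj (h0 : ∀ n, D (n + 1) * D n = 0) (h1 : ∀ n, EX (D n) (D (n + 1)) R)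
    (h2 : ∀ n, EX (D (n + 1))ᵀ (D n)ᵀ R) {C K : Type u} [AddCommGroup C] [Module R C]
    [AddCommGroup K] [Module R K] (hC : Module.Injective R C) {j : Fin (r 0) → (K →ₗ[R] C)}
    (hj : IsZ (D 0) j) : IsGorensteinInjective R K := by
  refine ⟨fun n => ModuleCat.of R (Fin (r n) → C), fun n => act (D n) C, ?_, ?_, ?_, ?_⟩
  · intro n
    exact Module.Injective.pi R (fun _ : Fin (r n) => C)
  · intro n
    ext x
    constructor
    · rintro ⟨y, rfl⟩
      change act (D (n + 1)) C (act (D n) C y) = 0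
      rw [act_act, h0, act_zero]
    · intro hx
      exact EX_inj h2 hC n x hx
  · intro I hI n φ hφ
    have hE : EX (D n) (D (n + 1)) (I →ₗ[R] C) :=
      EX_hom_of_injective hC (EX_inj' h1 hI n)
    obtain ⟨y, hy⟩ := hE (fun i => LinearMap.proj i ∘ₗ φ) (by
      funext k
      ext x
      have h3 := congrFun (LinearMap.congr_fun hφ x) k
      have h4 : act (D (n + 1)) C (φ x) k = 0 := h3
      rw [act_apply] at h4
      rw [act_apply]
      simpa [LinearMap.sum_apply] using h4)
    refine ⟨LinearMap.pi y, ?_⟩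
    refine LinearMap.ext fun x => funext fun k => ?_
    change act (D n) C (fun i => y i x) k = φ x k
    have h5 := LinearMap.congr_fun (congrFun hy k) x
    rw [act_apply] at h5
    rw [act_apply]
    simpa [LinearMap.sum_apply] using h5
  · refine ⟨LinearEquiv.ofBijective ((LinearMap.pi j).codRestrict (LinearMap.ker (act (D 0) C))
      fun x => hj.zero x) ⟨?_, ?_⟩⟩
    · rw [injective_iff_map_eq_zero]
      intro x hx
      exact hj.inj x fun i => congrFun (congrArg Subtype.val hx) i
    · rintro ⟨z, hz⟩
      obtain ⟨x, hx⟩ := hj.exact z hz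
      exact ⟨x, Subtype.ext (funext hx)⟩

theorem resolves {N : ℕ} (hid : idLE R R N)
    (hF : ∀ n p, p ∈ F n \ F (n + 1) ↔ p.asIdeal.height = n)
    (h0 : ∀ n, D (n + 1) * D n = 0) (h1 : ∀ n, EX (D n) (D (n + 1)) R)
    (h2 : ∀ n, EX (D (n + 1))ᵀ (D n)ᵀ R) :
    CousinResolves R F (ModuleCat.of R (LinearMap.ker (act (D 0) R)))
      (fun N => IsGorensteinInjective R N) := by
  refine ⟨?_, ?_, ?_, ?_⟩
  · intro n
    obtain ⟨j, hj⟩ := Z_all hid hF h0 h1 h2 0 n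
    exact hj.theta_mem (th_mem hid hF n)
  · obtain ⟨j, hj⟩ := Z_all hid hF h0 h1 h2 0 0
    exact hj.theta_inj (th_inj hid hF 0)
  · intro n
    obtain ⟨j, hj⟩ := Z_all hid hF h0 h1 h2 0 (n + 1)
    have hinj : Function.Injective (cousinTheta R F
      (ModuleCat.of R (LinearMap.ker (act (D 0) R))) (n + 1)) :=
      hj.theta_inj (th_inj hid hF (n + 1))
    unfold cousinD
    exact (LinearMap.ker_comp_of_ker_eq_bot _ (LinearMap.ker_eq_bot.mpr hinj)).trans
      (Submodule.ker_mkQ _)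
  · intro n
    obtain ⟨j, hj⟩ := Z_all hid hF h0 h1 h2 0 n
    exact gorInj h0 h1 h2 (C_inj hid hF n) (hj.fs (S := F n \ F (n + 1)))

end Main
end GGP

set_option linter.unusedSectionVars false

namespace GGP

open CategoryTheory Abelian IsLocalRing GG Matrix

section NotG

variable {R : Type u} [CommRing R]

theorem proj_of {a b c e : ℕ} {A : Matrix (Fin b) (Fin a) R} {B : Matrix (Fin a) (Fin c) R}
    {B2 : Matrix (Fin c) (Fin e) R} (hAB : A * B = 0) (hBB : B * B2 = 0) (h : EX Aᵀ Bᵀ R)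
    (hM : EX Bᵀ B2ᵀ (LinearMap.ker (act A R))) :
    Module.Projective R ((Fin a → R) ⧸ LinearMap.range (act Aᵀ R)) := by
  have hv : ∀ i : Fin c, act A R (fun k => B k i) = 0 := by
    intro i
    funext l
    rw [act_apply]
    exact congrFun (congrFun hAB l) i
  let v : Fin c → LinearMap.ker (act A R) := fun i => ⟨fun k => B k i, hv i⟩
  have hv2 : act B2ᵀ (LinearMap.ker (act A R)) v = 0 := by
    funext l
    apply Subtype.ext
    funext k
    have h1 := congrFun (act_map B2ᵀ (LinearMap.proj k ∘ₗ (LinearMap.ker (act A R)).subtype) v) l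
    refine Eq.trans h1.symm ?_
    rw [act_apply]
    have h2 := congrFun (congrFun hBB k) l
    rw [Matrix.mul_apply] at h2
    refine Eq.trans ?_ h2
    refine Finset.sum_congr rfl fun i _ => ?_
    exact mul_comm _ _
  obtain ⟨y, hy⟩ := hM v hv2
  let P : Matrix (Fin a) (Fin a) R := fun k k' => (y k').1 k
  have hAP : A * P = 0 := by
    ext l k'
    have h1 : act A R (y k').1 = 0 := (y k').2
    have h2 := congrFun h1 l
    rw [act_apply] at h2
    rw [Matrix.mul_apply]
    exact h2
  have hPB : P * B = B := by
    ext k i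
    have h1 := congrFun (act_map Bᵀ (LinearMap.proj k ∘ₗ (LinearMap.ker (act A R)).subtype) y) i
    rw [hy, act_apply] at h1
    rw [Matrix.mul_apply]
    refine Eq.trans ?_ h1
    refine Finset.sum_congr rfl fun i _ => ?_
    exact mul_comm _ _
  refine Module.Projective.of_split (M := Fin a → R)
    ((LinearMap.range (act Aᵀ R)).liftQ (act Pᵀ R) ?_) (LinearMap.range (act Aᵀ R)).mkQ ?_
  · rintro _ ⟨x, rfl⟩
    change act Pᵀ R (act Aᵀ R x) = 0
    rw [act_act, ← Matrix.transpose_mul, hAP, Matrix.transpose_zero, act_zero]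
  · refine LinearMap.ext fun q => ?_
    obtain ⟨x, rfl⟩ := Submodule.mkQ_surjective _ q
    change Submodule.Quotient.mk (act Pᵀ R x) = Submodule.Quotient.mk x
    rw [Submodule.Quotient.eq]
    apply h
    rw [map_sub, act_act, ← Matrix.transpose_mul, hPB, sub_self]

variable [IsNoetherianRing R] [IsLocalRing R] {F : ℕ → Set (PrimeSpectrum R)}
  {r : ℤ → ℕ} {D : ∀ n : ℤ, Matrix (Fin (r (n + 1))) (Fin (r n)) R}

theorem descend_all {N : ℕ} (hid : idLE R R N)
    (hF : ∀ n p, p ∈ F n \ F (n + 1) ↔ p.asIdeal.height = n)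
    (h0 : ∀ n, D (n + 1) * D n = 0) (h1 : ∀ n, EX (D n) (D (n + 1)) R)
    (h2 : ∀ n, EX (D (n + 1))ᵀ (D n)ᵀ R) (z : ℤ)
    (hinj : ∀ n, Module.Injective R
      (cousinC R F (ModuleCat.of R (LinearMap.ker (act (D z) R))) n)) (m : ℤ) :
    EX (D (m + 1))ᵀ (D m)ᵀ (LinearMap.ker (act (D z) R)) := by
  obtain ⟨d, hd⟩ : ∃ d : ℕ, (maximalIdeal R).height = d :=
    ⟨_, (ENat.natCast_toNat (Ideal.height_ne_top (maximalIdeal.isMaximal R).ne_top)).symm⟩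
  have key : ∀ k n : ℕ, n + k = d + 1 → ∀ m, EX (D (m + 1))ᵀ (D m)ᵀ
      (cousinK R F (ModuleCat.of R (LinearMap.ker (act (D z) R))) n) := by
    intro k
    induction k with
    | zero =>
      intro n hn m
      obtain ⟨j, hj⟩ := Z_all hid hF h0 h1 h2 z n
      have hin := hj.theta_inj (th_inj hid hF n)
      have : IsEmpty ↥(F n \ F (n + 1)) := by
        refine ⟨fun q => ?_⟩
        have h3 := (hF n q.1).mp q.2
        have h4 : q.1.asIdeal.height ≤ (maximalIdeal R).height :=
          Ideal.height_mono (le_maximalIdeal q.1.2.ne_top)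
        rw [h3, hd] at h4
        have : n ≤ d := by exact_mod_cast h4
        omega
      have := hin.subsingleton
      exact EX_of_subsingleton _ _
    | succ k ih =>
      intro n hn m
      obtain ⟨j, hj⟩ := Z_all hid hF h0 h1 h2 z n
      refine (next_ses (hj.theta_mem (th_mem hid hF n))
        (hj.theta_inj (th_inj hid hF n))).descend ?_ (EX_inj' h1 (hinj n) m)
        (ih (n + 1) (by omega) (m + 1))
      rw [← Matrix.transpose_mul, h0, Matrix.transpose_zero]
  exact key (d + 1) 0 (by omega) m

theorem proj_all {N : ℕ} (hid : idLE R R N)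
    (hF : ∀ n p, p ∈ F n \ F (n + 1) ↔ p.asIdeal.height = n)
    (h0 : ∀ n, D (n + 1) * D n = 0) (h1 : ∀ n, EX (D n) (D (n + 1)) R)
    (h2 : ∀ n, EX (D (n + 1))ᵀ (D n)ᵀ R) (z : ℤ)
    (hinj : ∀ n, Module.Injective R
      (cousinC R F (ModuleCat.of R (LinearMap.ker (act (D z) R))) n)) :
    Module.Projective R ((Fin (r z) → R) ⧸ LinearMap.range (act (D z)ᵀ R)) := by
  have h3 := descend_all hid hF h0 h1 h2 z hinj
  obtain ⟨k, rfl⟩ : ∃ k, z = k + 1 + 1 := ⟨z - 1 - 1, by ring⟩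
  exact proj_of (h0 (k + 1)) (h0 k) (h2 (k + 1)) (h3 k)

end NotG
end GGP

open GG in
/-- Over a non-regular Gorenstein local ring there is a G–Gorenstein module that is not
Gorenstein. -/
theorem stmt9 (R : Type u) [CommRing R] [IsLocalRing R] (hG : IsGorensteinLocalRing R)
    (hnr : ¬ IsRegularLocal R) :
    ∃ M : ModuleCat.{u} R, IsGGorenstein R M ∧ ¬ IsGorensteinModule R M := by
  obtain ⟨hN, N, hid⟩ := hG
  obtain ⟨r, D, h0, h1, h2, ⟨x, hx, hx0⟩, hproj⟩ := GGP.exists_tac N hid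
  have hsupp : ∀ p, p ∈ Module.support R (LinearMap.ker (GGP.act (D 0) R)) :=
    GGP.supp_of (⟨x, hx⟩ : LinearMap.ker (GGP.act (D 0) R))
      fun a ha => hx0 a (congrArg Subtype.val ha)
  have hF := GGP.hf_mem hsupp
  refine ⟨ModuleCat.of R (LinearMap.ker (GGP.act (D 0) R)), ⟨⟨⟨x, hx⟩, ?_⟩, ?_, ?_⟩, ?_⟩
  · intro h
    have h3 : x = 0 := congrArg Subtype.val h
    exact one_ne_zero (hx0 1 (by rw [h3, smul_zero]))
  · exact Module.Finite.of_fg (IsNoetherian.noetherian (LinearMap.ker (GGP.act (D 0) R)))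
  · exact GGP.resolves hid hF h0 h1 h2
  · rintro ⟨-, -, hC⟩
    obtain ⟨m, hm⟩ := hproj (GGP.proj_all hid hF h0 h1 h2 0 hC.2.2.2)
    exact hnr (GGP.serre_fin hm)
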